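/- arXiv:1903.02356 — 4 statements merged into one kernel-verified Lean document; each statement's English description precedes it below -/
import Mathlib

section
/- Let Φ ∈ C²(ℝ) satisfy |ξ||Φ''(ξ)| ≥ C₁ for all |ξ| ≥ 1, for some constant C₁ > 0. Let ψ ∈ C_0^∞(ℝ) be supported in (-2,-1/2) ∪ (1/2,2). Then there exists a constant C > 0 such that for all λ ≥ 2, all x, x' ∈ (-1,1), t, t' ∈ [-1,1], θ, θ' ∈ [-1,1] with 0 < |x − x'| < 4|t − t'|, the kernel K_λ = ∫_ℝ e^{i((x−x'+tθ−t'θ')λξ + (t−t')Φ(λξ))} ψ(ξ)² dξ satisfies |K_λ| ≤ C (λ|x − x'|)^{−1/2}. -/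
/-- A continuous function on `[a, b]` whose absolute value is bounded below by `μ > 0` has
constant sign. -/
lemma exists_sign_mul_ge {k : ℝ → ℝ} {a b μ : ℝ} (hk : ContinuousOn k (Set.Icc a b)) (hμ : 0 < μ)
    (h : ∀ ξ ∈ Set.Icc a b, μ ≤ |k ξ|) :
    ∃ σ : ℝ, |σ| = 1 ∧ ∀ ξ ∈ Set.Icc a b, μ ≤ σ * k ξ := by
  by_cases hpos : ∀ ξ ∈ Set.Icc a b, 0 < k ξ
  · refine ⟨1, by simp, fun ξ hξ => ?_⟩
    simpa [abs_of_pos (hpos ξ hξ)] using h ξ hξ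
  · push Not at hpos
    obtain ⟨p, hp, hkp⟩ := hpos
    refine ⟨-1, by simp, fun ξ hξ => ?_⟩
    have hneg : k ξ ≤ 0 := by
      by_contra! hc
      obtain ⟨z, hz, hkz⟩ := isPreconnected_Icc.intermediate_value hp hξ hk ⟨hkp, hc.le⟩
      have := h z hz
      rw [hkz, abs_zero] at this
      linarith
    have := h ξ hξ
    rw [abs_of_nonpos hneg] at this
    linarith

/-- The second derivative test of van der Corput, for an amplitude vanishing at the endpoints. -/
lemma norm_integral_exp_mul_le_of_le_second_deriv {f f' f'' g g' : ℝ → ℝ} {a b μ M σ : ℝ}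
    (hab : a ≤ b) (hμ : 0 < μ) (hσ : |σ| = 1)
    (hf : ∀ ξ, HasDerivAt f (f' ξ) ξ) (hf' : ∀ ξ, HasDerivAt f' (f'' ξ) ξ) (hf'' : Continuous f'')
    (hg : ∀ ξ, HasDerivAt g (g' ξ) ξ) (hg' : Continuous g') (ha : g a = 0) (hb : g b = 0)
    (hM : ∀ ξ, |g ξ| ≤ M) (hM' : ∀ ξ, |g' ξ| ≤ M)
    (hfμ : ∀ ξ ∈ Set.Icc a b, μ ≤ σ * f'' ξ) :
    ‖∫ ξ in a..b, Complex.exp (Complex.I * (f ξ : ℂ)) * (g ξ : ℂ)‖ ≤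
      M * ((b - a) / 2 + 2 * Real.pi) / √μ := by
  set ε := √μ with hε
  have hε0 : 0 < ε := Real.sqrt_pos.mpr hμ
  have hεμ : ε ^ 2 = μ := Real.sq_sqrt hμ.le
  have hM0 : 0 ≤ M := (abs_nonneg _).trans (hM a)
  have hfc : Continuous f := continuous_iff_continuousAt.mpr fun ξ => (hf ξ).continuousAt
  have hfc' : Continuous f' := continuous_iff_continuousAt.mpr fun ξ => (hf' ξ).continuousAt
  have hgc : Continuous g := continuous_iff_continuousAt.mpr fun ξ => (hg ξ).continuousAt
  set Q : ℝ → ℝ := fun ξ => f' ξ ^ 2 + ε ^ 2 with hQ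
  have hQ0 : ∀ ξ, 0 < Q ξ := fun ξ => by positivity
  have hQne : ∀ ξ, Q ξ ≠ 0 := fun ξ => (hQ0 ξ).ne'
  have hQc : Continuous Q := by fun_prop
  have hQd : ∀ ξ, HasDerivAt Q (2 * f' ξ * f'' ξ) ξ := fun ξ => by
    exact (((hf' ξ).pow 2).add_const (ε ^ 2)).congr_deriv (by simp)
  -- the real factor of the primitive, and its derivative
  set h : ℝ → ℝ := fun ξ => g ξ * f' ξ / Q ξ with hh
  set h' : ℝ → ℝ := fun ξ =>
    ((g' ξ * f' ξ + g ξ * f'' ξ) * Q ξ - g ξ * f' ξ * (2 * f' ξ * f'' ξ)) / Q ξ ^ 2 with hh'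
  have hhd : ∀ ξ, HasDerivAt h (h' ξ) ξ := fun ξ => ((hg ξ).mul (hf' ξ)).div (hQd ξ) (hQne ξ)
  have hhc : Continuous h := (hgc.mul hfc').div hQc hQne
  have hhc' : Continuous h' :=
    Continuous.div (by fun_prop) (by fun_prop) fun ξ => pow_ne_zero 2 (hQne ξ)
  set e : ℝ → ℂ := fun ξ => Complex.exp (Complex.I * (f ξ : ℂ)) with he
  have hec : Continuous e := by fun_prop
  have hen : ∀ ξ, ‖e ξ‖ = 1 := fun ξ => by
    simp only [he]; rw [mul_comm, Complex.norm_exp_ofReal_mul_I]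
  have hed : ∀ ξ, HasDerivAt e (e ξ * (Complex.I * (f' ξ : ℂ))) ξ := fun ξ =>
    ((hf ξ).ofReal_comp.const_mul Complex.I).cexp
  set F : ℝ → ℂ := fun ξ => -Complex.I * (e ξ * (h ξ : ℂ)) with hF
  set F' : ℝ → ℂ := fun ξ =>
    -Complex.I * (e ξ * (Complex.I * (f' ξ : ℂ)) * (h ξ : ℂ) + e ξ * (h' ξ : ℂ)) with hF'
  have hFd : ∀ ξ, HasDerivAt F (F' ξ) ξ := fun ξ =>
    ((hed ξ).mul (hhd ξ).ofReal_comp).const_mul _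
  have hFc' : Continuous F' := by fun_prop
  have hFint : ∫ ξ in a..b, F' ξ = 0 := by
    rw [intervalIntegral.integral_eq_sub_of_hasDerivAt (fun ξ _ => hFd ξ)
      (hFc'.intervalIntegrable _ _)]
    simp [hF, hh, ha, hb]
  -- the majorant and its primitive
  set B : ℝ → ℝ := fun ξ => M / (2 * ε) * ξ + 2 * M * σ / ε * Real.arctan (f' ξ / ε) with hB
  set B' : ℝ → ℝ := fun ξ => M / (2 * ε) + 2 * M * (σ * f'' ξ) / Q ξ with hB'
  have hBd : ∀ ξ, HasDerivAt B (B' ξ) ξ := fun ξ => by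
    have h1 := ((hasDerivAt_id ξ).const_mul (M / (2 * ε))).add
      ((((hf' ξ).div_const ε).arctan).const_mul (2 * M * σ / ε))
    refine h1.congr_deriv ?_
    have := hQne ξ
    have h2 : 1 + (f' ξ / ε) ^ 2 = Q ξ / ε ^ 2 := by
      simp only [hQ]; field_simp; ring
    rw [h2]
    simp only [hB']
    field_simp
  have hBc' : Continuous B' := by
    exact continuous_const.add (Continuous.div (by fun_prop) hQc hQne)
  have hBint : ∫ ξ in a..b, B' ξ ≤ M * ((b - a) / 2 + 2 * Real.pi) / ε := by
    rw [intervalIntegral.integral_eq_sub_of_hasDerivAt (fun ξ _ => hBd ξ)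
      (hBc'.intervalIntegrable _ _)]
    have h1 : σ * (Real.arctan (f' b / ε) - Real.arctan (f' a / ε)) ≤ Real.pi := by
      refine (le_abs_self _).trans ?_
      rw [abs_mul, hσ, one_mul, abs_le]
      have := Real.arctan_lt_pi_div_two (f' b / ε)
      have := Real.arctan_lt_pi_div_two (f' a / ε)
      have := Real.neg_pi_div_two_lt_arctan (f' b / ε)
      have := Real.neg_pi_div_two_lt_arctan (f' a / ε)
      constructor <;> linarith
    have h2 : B b - B a = M * ((b - a) / 2 +
        2 * (σ * (Real.arctan (f' b / ε) - Real.arctan (f' a / ε)))) / ε := by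
      simp only [hB]; field_simp; ring
    rw [h2]
    gcongr
  have hpt : ∀ ξ ∈ Set.Icc a b, ‖e ξ * (g ξ : ℂ) - F' ξ‖ ≤ B' ξ := fun ξ hξ => by
    have hμξ := hfμ ξ hξ
    have hq := hQ0 ξ
    have hqne := hQne ξ
    have hsplit : e ξ * (g ξ : ℂ) - F' ξ =
        e ξ * ((g ξ * ε ^ 2 / Q ξ : ℝ) + Complex.I * (h' ξ : ℂ)) := by
      have h1 : g ξ - f' ξ * h ξ = g ξ * ε ^ 2 / Q ξ := by
        simp only [hh]; field_simp; simp only [hQ]; ring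
      rw [← h1]
      simp only [hF']
      push_cast
      linear_combination e ξ * (f' ξ : ℂ) * (h ξ : ℂ) * Complex.I_sq
    have hmain : |g ξ * ε ^ 2 / Q ξ| ≤ M * (σ * f'' ξ) / Q ξ := by
      rw [abs_div, abs_mul, abs_of_pos hq, abs_of_nonneg (sq_nonneg ε), hεμ]
      gcongr
      exact hM ξ
    have habs : |f'' ξ| = σ * f'' ξ := by
      have h1 : |σ * f'' ξ| = |f'' ξ| := by rw [abs_mul, hσ, one_mul]
      rw [← h1, abs_of_pos (hμ.trans_le hμξ)]
    have hder : |h' ξ| ≤ M / (2 * ε) + M * (σ * f'' ξ) / Q ξ := by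
      have h1 : h' ξ = g' ξ * (f' ξ / Q ξ) + g ξ * f'' ξ / Q ξ * ((ε ^ 2 - f' ξ ^ 2) / Q ξ) := by
        simp only [hh']; field_simp; simp only [hQ]; ring
      have h2 : |f' ξ / Q ξ| ≤ 1 / (2 * ε) := by
        rw [abs_div, abs_of_pos hq, div_le_div_iff₀ hq (by positivity)]
        simp only [hQ]
        nlinarith [sq_nonneg (|f' ξ| - ε), sq_abs (f' ξ)]
      have h3 : |(ε ^ 2 - f' ξ ^ 2) / Q ξ| ≤ 1 := by
        rw [abs_div, abs_of_pos hq, div_le_one hq, abs_le]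
        simp only [hQ]
        constructor <;> nlinarith [sq_nonneg ε, sq_nonneg (f' ξ)]
      rw [h1]
      refine (abs_add_le _ _).trans (add_le_add ?_ ?_)
      · rw [abs_mul]
        calc |g' ξ| * |f' ξ / Q ξ| ≤ M * (1 / (2 * ε)) :=
              mul_le_mul (hM' ξ) h2 (abs_nonneg _) hM0
          _ = M / (2 * ε) := by ring
      · rw [abs_mul, abs_div, abs_mul, abs_of_pos hq, habs]
        have h4 : 0 ≤ σ * f'' ξ := (hμ.trans_le hμξ).le
        calc |g ξ| * (σ * f'' ξ) / Q ξ * |(ε ^ 2 - f' ξ ^ 2) / Q ξ|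
            ≤ |g ξ| * (σ * f'' ξ) / Q ξ * 1 := by gcongr
          _ ≤ M * (σ * f'' ξ) / Q ξ := by
            rw [mul_one]
            gcongr
            exact hM ξ
    rw [hsplit, norm_mul, hen, one_mul]
    refine (norm_add_le _ _).trans ?_
    rw [norm_mul, Complex.norm_I, one_mul, Complex.norm_real, Complex.norm_real,
      Real.norm_eq_abs, Real.norm_eq_abs]
    calc _ ≤ M * (σ * f'' ξ) / Q ξ + (M / (2 * ε) + M * (σ * f'' ξ) / Q ξ) := add_le_add hmain hder
      _ = B' ξ := by simp only [hB']; ring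
  have hegc : Continuous fun ξ => e ξ * (g ξ : ℂ) := by fun_prop
  have hrew : ∫ ξ in a..b, e ξ * (g ξ : ℂ) = ∫ ξ in a..b, (e ξ * (g ξ : ℂ) - F' ξ) := by
    rw [intervalIntegral.integral_sub (hegc.intervalIntegrable _ _)
      (hFc'.intervalIntegrable _ _), hFint, sub_zero]
  rw [hrew]
  refine le_trans ?_ hBint
  refine intervalIntegral.norm_integral_le_of_norm_le hab ?_ (hBc'.intervalIntegrable _ _)
  exact Filter.Eventually.of_forall fun ξ hξ => hpt ξ (Set.Ioc_subset_Icc_self hξ)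

theorem statement8 (Φ : ℝ → ℝ) (hΦ : ContDiff ℝ 2 Φ)
    (C₁ : ℝ) (hC₁ : 0 < C₁)
    (hΦ1 : ∀ ξ : ℝ, 1 ≤ |ξ| → C₁ ≤ |ξ| * |deriv (deriv Φ) ξ|)
    (ψ : ℝ → ℝ) (hψ : ContDiff ℝ (⊤ : ℕ∞) ψ) (hψc : HasCompactSupport ψ)
    (hψs : tsupport ψ ⊆ Set.Ioo (-2 : ℝ) (-1/2) ∪ Set.Ioo (1/2 : ℝ) 2) :
    ∃ C : ℝ, 0 < C ∧ ∀ lam x x' t t' θ θ' : ℝ, 2 ≤ lam →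
      x ∈ Set.Ioo (-1 : ℝ) 1 → x' ∈ Set.Ioo (-1 : ℝ) 1 →
      t ∈ Set.Icc (-1 : ℝ) 1 → t' ∈ Set.Icc (-1 : ℝ) 1 →
      θ ∈ Set.Icc (-1 : ℝ) 1 → θ' ∈ Set.Icc (-1 : ℝ) 1 →
      0 < |x - x'| → |x - x'| < 4 * |t - t'| →
      ‖∫ ξ : ℝ, Complex.exp (Complex.I *
            (((x - x' + t * θ - t' * θ') * (lam * ξ) + (t - t') * Φ (lam * ξ) : ℝ) : ℂ)) *
          ((ψ ξ : ℝ) : ℂ) ^ 2‖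
        ≤ C * (lam * |x - x'|) ^ (-(1 : ℝ) / 2) := by
  have hΦ' : ContDiff ℝ 1 (deriv Φ) := by
    have h2 : ContDiff ℝ (1 + 1) Φ := by simpa [one_add_one_eq_two] using hΦ
    exact (contDiff_succ_iff_deriv.mp h2).2.2
  have hΦd : ∀ η, HasDerivAt Φ (deriv Φ η) η := fun η =>
    (hΦ.differentiable (by norm_num) η).hasDerivAt
  have hΦd' : ∀ η, HasDerivAt (deriv Φ) (deriv (deriv Φ) η) η := fun η =>
    (hΦ'.differentiable (by norm_num) η).hasDerivAt
  have hΦc'' : Continuous (deriv (deriv Φ)) := hΦ'.continuous_deriv le_rfl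
  have hψcont : Continuous ψ := hψ.continuous
  have hψd : ∀ ξ, HasDerivAt ψ (deriv ψ ξ) ξ := fun ξ =>
    (hψ.differentiable (by simp) ξ).hasDerivAt
  have hψc' : Continuous (deriv ψ) := hψ.continuous_deriv (by simp)
  have hψ0 : ∀ ξ, ξ ∉ Set.Ioo (-2 : ℝ) (-1/2) ∪ Set.Ioo (1/2 : ℝ) 2 → ψ ξ = 0 := fun ξ hξ =>
    image_eq_zero_of_notMem_tsupport fun h => hξ (hψs h)
  set g : ℝ → ℝ := fun ξ => ψ ξ ^ 2 with hg
  set g' : ℝ → ℝ := fun ξ => 2 * ψ ξ * deriv ψ ξ with hg'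
  have hgd : ∀ ξ, HasDerivAt g (g' ξ) ξ := fun ξ =>
    ((hψd ξ).pow 2).congr_deriv (by simp [hg'])
  have hgc' : Continuous g' := by fun_prop
  obtain ⟨M₁, hM₁⟩ := hψcont.bounded_above_of_compact_support hψc
  obtain ⟨M₂, hM₂⟩ := hψc'.bounded_above_of_compact_support hψc.deriv
  have hM₁0 : 0 ≤ M₁ := (norm_nonneg _).trans (hM₁ 0)
  have hM₂0 : 0 ≤ M₂ := (norm_nonneg _).trans (hM₂ 0)
  set M : ℝ := M₁ ^ 2 + 2 * M₁ * M₂ + 1 with hMdef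
  have hMpos : 0 < M := by positivity
  have hgM : ∀ ξ, |g ξ| ≤ M := fun ξ => by
    have h1 : |ψ ξ| ^ 2 ≤ M₁ ^ 2 := pow_le_pow_left₀ (abs_nonneg _) (hM₁ ξ) 2
    have h2 : 0 ≤ M₁ * M₂ := by positivity
    simp only [hg, abs_pow]
    linarith
  have hgM' : ∀ ξ, |g' ξ| ≤ M := fun ξ => by
    have h1 : |ψ ξ| * |deriv ψ ξ| ≤ M₁ * M₂ := mul_le_mul (hM₁ ξ) (hM₂ ξ) (abs_nonneg _) hM₁0
    have h2 : 0 ≤ M₁ ^ 2 := by positivity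
    simp only [hg', abs_mul, abs_two]
    linarith
  have hDpos : 0 < 3 / 4 + 2 * Real.pi := by have := Real.pi_pos; positivity
  refine ⟨2 * (M * (3 / 4 + 2 * Real.pi)) / √(C₁ / 8), by positivity, ?_⟩
  intro lam x x' t t' θ θ' hlam _ _ _ _ _ _ hx hxt
  have hlam0 : 0 < lam := by linarith
  set s : ℝ := lam * |x - x'| with hs
  have hs0 : 0 < s := by positivity
  set A : ℝ := x - x' + t * θ - t' * θ' with hA
  set f : ℝ → ℝ := fun ξ => A * (lam * ξ) + (t - t') * Φ (lam * ξ) with hf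
  set f' : ℝ → ℝ := fun ξ => A * lam + (t - t') * (deriv Φ (lam * ξ) * lam) with hf'
  set f'' : ℝ → ℝ := fun ξ => (t - t') * (deriv (deriv Φ) (lam * ξ) * lam * lam) with hf''
  have hlin : ∀ ξ, HasDerivAt (fun ξ : ℝ => lam * ξ) lam ξ := fun ξ => by
    simpa using (hasDerivAt_id ξ).const_mul lam
  have hfd : ∀ ξ, HasDerivAt f (f' ξ) ξ := fun ξ =>
    ((hlin ξ).const_mul A).add (((hΦd (lam * ξ)).comp ξ (hlin ξ)).const_mul (t - t'))
  have hfd' : ∀ ξ, HasDerivAt f' (f'' ξ) ξ := fun ξ =>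
    ((((hΦd' (lam * ξ)).comp ξ (hlin ξ)).mul_const lam).const_mul (t - t')).const_add (A * lam)
  have hfc'' : Continuous f'' := by fun_prop
  have hμ0 : 0 < C₁ / 8 * s := by positivity
  have hlower : ∀ ξ : ℝ, 1 / 2 ≤ |ξ| → |ξ| ≤ 2 → C₁ / 8 * s ≤ |f'' ξ| := fun ξ h1 h2 => by
    have h3 : |lam * ξ| = lam * |ξ| := by rw [abs_mul, abs_of_pos hlam0]
    have h4 := hΦ1 (lam * ξ) (by rw [h3]; nlinarith)
    rw [h3] at h4
    set w := |deriv (deriv Φ) (lam * ξ)| with hw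
    have hw0 : 0 ≤ w := abs_nonneg _
    have h5 : C₁ ≤ 2 * (w * lam) := by
      have : lam * |ξ| * w ≤ lam * 2 * w := by gcongr
      linarith
    have h6 : |f'' ξ| = |t - t'| * (w * lam * lam) := by
      simp only [hf'', abs_mul, abs_of_pos hlam0, hw]
    rw [h6, hs]
    calc C₁ / 8 * (lam * |x - x'|) ≤ C₁ / 8 * (lam * (4 * |t - t'|)) := by gcongr
      _ = C₁ * (lam * |t - t'| / 2) := by ring
      _ ≤ 2 * (w * lam) * (lam * |t - t'| / 2) := by gcongr
      _ = _ := by ring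
  have hpiece : ∀ a b : ℝ, b - a = 3 / 2 → g a = 0 → g b = 0 →
      (∀ ξ ∈ Set.Icc a b, 1 / 2 ≤ |ξ| ∧ |ξ| ≤ 2) →
      ‖∫ ξ in a..b, Complex.exp (Complex.I * (f ξ : ℂ)) * (g ξ : ℂ)‖ ≤
        M * (3 / 4 + 2 * Real.pi) / √(C₁ / 8 * s) := by
    intro a b hab ha hb hξ
    obtain ⟨σ, hσ, hσf⟩ := exists_sign_mul_ge hfc''.continuousOn hμ0
      fun ξ h => hlower ξ (hξ ξ h).1 (hξ ξ h).2
    have := norm_integral_exp_mul_le_of_le_second_deriv (by linarith) hμ0 hσ hfd hfd' hfc''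
      hgd hgc' ha hb hgM hgM' hσf
    rw [hab] at this
    convert this using 4
    norm_num
  have hpos := hpiece (1 / 2) 2 (by norm_num)
    (by simp only [hg]; rw [hψ0 _ (by norm_num)]; simp)
    (by simp only [hg]; rw [hψ0 _ (by norm_num)]; simp)
    (fun ξ h => by rw [abs_of_nonneg (by linarith [h.1])]; exact h)
  have hneg := hpiece (-2) (-1 / 2) (by norm_num)
    (by simp only [hg]; rw [hψ0 _ (by norm_num)]; simp)
    (by simp only [hg]; rw [hψ0 _ (by norm_num)]; simp)
    (fun ξ h => by
      rw [abs_of_nonpos (by linarith [h.2])]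
      constructor <;> linarith [h.1, h.2])
  set G : ℝ → ℂ := fun ξ => Complex.exp (Complex.I * (f ξ : ℂ)) * (g ξ : ℂ) with hG
  have hfc : Continuous f := continuous_iff_continuousAt.mpr fun ξ => (hfd ξ).continuousAt
  have hGc : Continuous G := by fun_prop
  have hsplit : ∫ ξ, G ξ = (∫ ξ in (-2 : ℝ)..(-1 / 2), G ξ) + ∫ ξ in (1 / 2 : ℝ)..2, G ξ := by
    rw [intervalIntegral.integral_of_le (by norm_num), intervalIntegral.integral_of_le (by norm_num),
      ← MeasureTheory.setIntegral_union _ measurableSet_Ioc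
        (hGc.integrableOn_Ioc) (hGc.integrableOn_Ioc)]
    · refine (MeasureTheory.setIntegral_eq_integral_of_forall_compl_eq_zero fun ξ hξ => ?_).symm
      have : ψ ξ = 0 := hψ0 ξ fun h => hξ
        (Set.union_subset_union Set.Ioo_subset_Ioc_self Set.Ioo_subset_Ioc_self h)
      simp [hG, hg, this]
    · rw [Set.disjoint_left]
      intro ξ h1 h2
      linarith [h1.2, h2.1]
  have hgoal : (fun ξ : ℝ => Complex.exp (Complex.I *
      ((A * (lam * ξ) + (t - t') * Φ (lam * ξ) : ℝ) : ℂ)) * ((ψ ξ : ℝ) : ℂ) ^ 2) = G := by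
    funext ξ
    simp only [hG, hg, hf, Complex.ofReal_pow]
  rw [hgoal, hsplit]
  refine (norm_add_le _ _).trans ((add_le_add hneg hpos).trans_eq ?_)
  rw [show -(1 : ℝ) / 2 = -(1 / 2) by norm_num, Real.rpow_neg hs0.le, ← Real.sqrt_eq_rpow,
    Real.sqrt_mul (by positivity)]
  have : √s ≠ 0 := (Real.sqrt_pos.mpr hs0).ne'
  field_simp
  ring
end

section
/- Let Φ ∈ C²(ℝ) satisfy, for some constants C₁, C₂ > 0, |ξ||Φ''(ξ)| ≥ C₁ and |ξ||Φ''(ξ)| ≥ C₂|Φ'(ξ)| for all |ξ| ≥ 1. Let ψ ∈ C_0^∞(ℝ) be supported in (-2,-1/2) ∪ (1/2,2) and let 0 < σ ≤ 1. Then there is a constant C > 0 such that for all λ = 2^k with integer k ≥ 1, and all x, x' ∈ (-1,1), t, t' ∈ [-1,1], θ, θ' ∈ [-1,1] with |θ − θ'| ≤ λ^{−σ}, |x − x'| ≥ 4|t − t'| and |x − x'| ≥ 4λ^{−σ}, the kernel K_λ = ∫_ℝ e^{i((x−x'+tθ−t'θ')λξ + (t−t')Φ(λξ))} ψ(ξ)²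 dξ satisfies |K_λ| ≤ C (λ|x − x'|)^{−1/2}. -/
open MeasureTheory

/-- The total variation of `arctan (u / δ)` along a monotone function `u` is at most `π`. -/
lemma integral_abs_deriv_mul_div_sq_add_sq_le_pi {a b δ : ℝ} (hab : a ≤ b) (hδ : 0 < δ)
    {u u' : ℝ → ℝ} (hu : ∀ ξ, HasDerivAt u (u' ξ) ξ) (hu' : Continuous u')
    (hsign : (∀ ξ ∈ Set.Icc a b, 0 ≤ u' ξ) ∨ ∀ ξ ∈ Set.Icc a b, u' ξ ≤ 0) :
    ∫ ξ in a..b, |u' ξ| * δ / (u ξ ^ 2 + δ ^ 2) ≤ Real.pi := by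
  have hcont : Continuous u := continuous_iff_continuousAt.2 fun ξ => (hu ξ).continuousAt
  have hpos : ∀ ξ, 0 < u ξ ^ 2 + δ ^ 2 := fun ξ => by positivity
  have hd : ∀ ξ, HasDerivAt (fun y => Real.arctan (u y / δ))
      (u' ξ * δ / (u ξ ^ 2 + δ ^ 2)) ξ := fun ξ => by
    convert ((hu ξ).div_const δ).arctan using 1
    have := (hpos ξ).ne'
    have : δ ^ 2 + u ξ ^ 2 ≠ 0 := by rwa [add_comm]
    field_simp
    ring
  have hc : Continuous fun ξ => u' ξ * δ / (u ξ ^ 2 + δ ^ 2) :=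
    (by fun_prop : Continuous fun ξ => u' ξ * δ).div (by fun_prop) fun ξ => (hpos ξ).ne'
  have hint : ∫ ξ in a..b, u' ξ * δ / (u ξ ^ 2 + δ ^ 2)
      = Real.arctan (u b / δ) - Real.arctan (u a / δ) :=
    intervalIntegral.integral_eq_sub_of_hasDerivAt (fun ξ _ => hd ξ) (hc.intervalIntegrable _ _)
  have := Real.arctan_lt_pi_div_two (u b / δ)
  have := Real.arctan_lt_pi_div_two (u a / δ)
  have := Real.neg_pi_div_two_lt_arctan (u b / δ)
  have := Real.neg_pi_div_two_lt_arctan (u a / δ)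
  rcases hsign with h | h
  · have : ∫ ξ in a..b, |u' ξ| * δ / (u ξ ^ 2 + δ ^ 2)
        = ∫ ξ in a..b, u' ξ * δ / (u ξ ^ 2 + δ ^ 2) := by
      refine intervalIntegral.integral_congr fun ξ hξ => ?_
      rw [Set.uIcc_of_le hab] at hξ
      simp only [abs_of_nonneg (h ξ hξ)]
    linarith
  · have : ∫ ξ in a..b, |u' ξ| * δ / (u ξ ^ 2 + δ ^ 2)
        = ∫ ξ in a..b, -(u' ξ * δ / (u ξ ^ 2 + δ ^ 2)) := by
      refine intervalIntegral.integral_congr fun ξ hξ => ?_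
      rw [Set.uIcc_of_le hab] at hξ
      simp only [abs_of_nonpos (h ξ hξ)]
      ring
    rw [intervalIntegral.integral_neg] at this
    linarith

/-- The two weights produced by integrating by parts against `u / (u² + δ²)`, where `u` and `v`
are the first and second derivative of the phase. -/
lemma weight_bounds {c δ : ℝ} (hc : 0 < c) (hδ : 0 < δ) (u v : ℝ)
    (h : c * δ ^ 2 ≤ |u| ∨ c * δ ^ 2 ≤ |v|) :
    |u / (u ^ 2 + δ ^ 2)| ≤ 1 / (2 * δ) ∧
    |(δ ^ 2 - u ^ 2) / (u ^ 2 + δ ^ 2) ^ 2 * v| ≤ |v| * δ / (u ^ 2 + δ ^ 2) / δ ∧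
    δ ^ 2 / (u ^ 2 + δ ^ 2) ≤
      1 / (c ^ 2 * δ ^ 2) + |v| * δ / (u ^ 2 + δ ^ 2) / (c * δ) := by
  have hpos : 0 < u ^ 2 + δ ^ 2 := by positivity
  refine ⟨?_, ?_, ?_⟩
  · rw [abs_div, abs_of_pos hpos, div_le_div_iff₀ hpos (by positivity)]
    nlinarith [sq_nonneg (|u| - δ), sq_abs u]
  · have e : |v| * δ / (u ^ 2 + δ ^ 2) / δ = 1 / (u ^ 2 + δ ^ 2) * |v| := by field_simp
    rw [e, abs_mul, abs_div, abs_of_pos (pow_pos hpos 2)]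
    refine mul_le_mul_of_nonneg_right ?_ (abs_nonneg _)
    rw [div_le_div_iff₀ (pow_pos hpos 2) hpos]
    have : |δ ^ 2 - u ^ 2| ≤ u ^ 2 + δ ^ 2 := by
      rw [abs_le]; constructor <;> nlinarith [sq_nonneg u, sq_nonneg δ]
    nlinarith
  · rcases h with h | h
    · have h2 : (c * δ ^ 2) ^ 2 ≤ u ^ 2 := by
        rw [← sq_abs u]; exact pow_le_pow_left₀ (by positivity) h 2
      have : δ ^ 2 / (u ^ 2 + δ ^ 2) ≤ 1 / (c ^ 2 * δ ^ 2) := by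
        rw [div_le_div_iff₀ hpos (by positivity)]
        nlinarith [sq_nonneg δ]
      have : 0 ≤ |v| * δ / (u ^ 2 + δ ^ 2) / (c * δ) := by positivity
      linarith
    · have e : |v| * δ / (u ^ 2 + δ ^ 2) / (c * δ) = (|v| / c) / (u ^ 2 + δ ^ 2) := by
        field_simp
      have : δ ^ 2 / (u ^ 2 + δ ^ 2) ≤ |v| * δ / (u ^ 2 + δ ^ 2) / (c * δ) := by
        rw [e]
        refine div_le_div_of_nonneg_right ?_ hpos.le
        rw [le_div_iff₀ hc]; linarith
      have : 0 ≤ 1 / (c ^ 2 * δ ^ 2) := by positivity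
      linarith

/-- A van der Corput estimate: the derivative of the phase is monotone, and at each point either
the first or the second derivative of the phase is at least `c * δ ^ 2`. -/
lemma norm_integral_exp_mul_le_div {a b c δ M M' : ℝ} (hab : a ≤ b) (hc : 0 < c) (hδ : 1 ≤ δ)
    {F F' F'' g g' : ℝ → ℝ} (hF : ∀ ξ, HasDerivAt F (F' ξ) ξ)
    (hF' : ∀ ξ, HasDerivAt F' (F'' ξ) ξ) (hF'' : Continuous F'')
    (hg : ∀ ξ, HasDerivAt g (g' ξ) ξ) (hg' : Continuous g')
    (hga : g a = 0) (hgb : g b = 0) (hM : ∀ ξ, |g ξ| ≤ M) (hM' : ∀ ξ, |g' ξ| ≤ M')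
    (hsign : (∀ ξ ∈ Set.Icc a b, 0 ≤ F'' ξ) ∨ ∀ ξ ∈ Set.Icc a b, F'' ξ ≤ 0)
    (hlow : ∀ ξ ∈ Set.Icc a b, c * δ ^ 2 ≤ |F' ξ| ∨ c * δ ^ 2 ≤ |F'' ξ|) :
    ‖∫ ξ in a..b, Complex.exp (Complex.I * (F ξ : ℂ)) * (g ξ : ℂ)‖ ≤
      (M * (Real.pi / c + Real.pi) + (M * (1 / c ^ 2) + M') * (b - a)) / δ := by
  have hδ0 : 0 < δ := by linarith
  have hM0 : 0 ≤ M := (abs_nonneg _).trans (hM 0)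
  have hM'0 : 0 ≤ M' := (abs_nonneg _).trans (hM' 0)
  have hpos : ∀ ξ, 0 < F' ξ ^ 2 + δ ^ 2 := fun ξ => by positivity
  have cF : Continuous F := continuous_iff_continuousAt.2 fun ξ => (hF ξ).continuousAt
  have cF' : Continuous F' := continuous_iff_continuousAt.2 fun ξ => (hF' ξ).continuousAt
  have cg : Continuous g := continuous_iff_continuousAt.2 fun ξ => (hg ξ).continuousAt
  set h : ℝ → ℝ := fun ξ => F' ξ / (F' ξ ^ 2 + δ ^ 2) with hh
  set h' : ℝ → ℝ := fun ξ => (δ ^ 2 - F' ξ ^ 2) / (F' ξ ^ 2 + δ ^ 2) ^ 2 * F'' ξ with hh'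
  set p : ℝ → ℝ := fun ξ => δ ^ 2 / (F' ξ ^ 2 + δ ^ 2) with hp
  set w : ℝ → ℝ := fun ξ => |F'' ξ| * δ / (F' ξ ^ 2 + δ ^ 2) with hw
  have ch : Continuous h := cF'.div (by fun_prop) fun ξ => (hpos ξ).ne'
  have ch' : Continuous h' := ((by fun_prop : Continuous fun ξ => δ ^ 2 - F' ξ ^ 2).div
    (by fun_prop) fun ξ => (pow_pos (hpos ξ) 2).ne').mul hF''
  have cp : Continuous p := continuous_const.div (by fun_prop) fun ξ => (hpos ξ).ne'
  have cw : Continuous w := (by fun_prop : Continuous fun ξ => |F'' ξ| * δ).div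
    (by fun_prop) fun ξ => (hpos ξ).ne'
  have dh : ∀ ξ, HasDerivAt h (h' ξ) ξ := fun ξ => by
    refine ((hF' ξ).fun_div (((hF' ξ).fun_pow 2).add_const (δ ^ 2)) (hpos ξ).ne').congr_deriv ?_
    simp only [hh']
    rw [div_mul_eq_mul_div]
    congr 1
    push_cast
    ring
  have hone : ∀ ξ, F' ξ * h ξ = 1 - p ξ := fun ξ => by
    have := (hpos ξ).ne'
    simp only [hh, hp]
    field_simp
    ring
  let E : ℝ → ℂ := fun ξ => Complex.exp (Complex.I * (F ξ : ℂ))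
  have cE : Continuous E := by fun_prop
  have nE : ∀ ξ, ‖E ξ‖ = 1 := fun ξ => by
    simp only [E]
    rw [mul_comm, Complex.norm_exp_ofReal_mul_I]
  have dE : ∀ ξ, HasDerivAt E (E ξ * (Complex.I * (F' ξ : ℂ))) ξ := fun ξ =>
    ((hF ξ).ofReal_comp.const_mul Complex.I).cexp
  let R : ℝ → ℂ := fun ξ => E ξ * ((g ξ * p ξ : ℝ) + Complex.I * (h' ξ * g ξ + h ξ * g' ξ : ℝ))
  have cR : Continuous R := by fun_prop
  have dT : ∀ ξ, HasDerivAt (fun y => E y * ((h y * g y : ℝ) : ℂ))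
      (Complex.I * (E ξ * g ξ - R ξ)) ξ := fun ξ => by
    refine ((dE ξ).fun_mul ((dh ξ).fun_mul (hg ξ)).ofReal_comp).congr_deriv ?_
    have h1 : (F' ξ : ℂ) * h ξ = 1 - p ξ := by exact_mod_cast hone ξ
    simp only [R]
    push_cast
    linear_combination (Complex.I * E ξ * g ξ) * h1 +
      (E ξ * (h' ξ * g ξ + h ξ * g' ξ)) * Complex.I_sq
  have hzero : ∫ ξ in a..b, Complex.I * (E ξ * g ξ - R ξ) = 0 := by
    rw [intervalIntegral.integral_eq_sub_of_hasDerivAt (fun ξ _ => dT ξ)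
      ((by fun_prop : Continuous fun ξ => Complex.I * (E ξ * g ξ - R ξ)).intervalIntegrable _ _)]
    simp [hga, hgb]
  have heq : ∫ ξ in a..b, E ξ * g ξ = ∫ ξ in a..b, R ξ := by
    rw [intervalIntegral.integral_const_mul, intervalIntegral.integral_sub
      ((by fun_prop : Continuous fun ξ => E ξ * (g ξ : ℂ)).intervalIntegrable _ _)
      (cR.intervalIntegrable _ _)] at hzero
    simpa [sub_eq_zero] using hzero
  have hbound : ∀ ξ ∈ Set.Icc a b, ‖R ξ‖ ≤
      (M * (1 / c ^ 2) + M') / δ + (M * (1 / c + 1) / δ) * w ξ := fun ξ hξ => by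
    obtain ⟨b1, b2, b3⟩ := weight_bounds hc hδ0 (F' ξ) (F'' ξ) (hlow ξ hξ)
    have hp0 : 0 ≤ p ξ := by have := hpos ξ; positivity
    have hw0 : 0 ≤ w ξ := by have := hpos ξ; positivity
    have t1 : ‖((g ξ * p ξ : ℝ) : ℂ)‖ ≤ M * (1 / (c ^ 2 * δ ^ 2) + w ξ / (c * δ)) := by
      rw [Complex.norm_real, Real.norm_eq_abs, abs_mul, abs_of_nonneg hp0]
      exact mul_le_mul (hM ξ) b3 hp0 hM0
    have t2 : ‖Complex.I * ((h' ξ * g ξ + h ξ * g' ξ : ℝ) : ℂ)‖ ≤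
        w ξ / δ * M + 1 / (2 * δ) * M' := by
      rw [norm_mul, Complex.norm_I, one_mul, Complex.norm_real, Real.norm_eq_abs]
      refine (abs_add_le _ _).trans ?_
      rw [abs_mul (h' ξ), abs_mul (h ξ)]
      exact add_le_add (mul_le_mul b2 (hM ξ) (abs_nonneg _) (by positivity))
        (mul_le_mul b1 (hM' ξ) (abs_nonneg _) (by positivity))
    have t3 : 1 / (c ^ 2 * δ ^ 2) ≤ 1 / (c ^ 2 * δ) :=
      one_div_le_one_div_of_le (by positivity)
        (mul_le_mul_of_nonneg_left (by nlinarith) (by positivity))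
    have t4 : 1 / (2 * δ) ≤ 1 / δ := one_div_le_one_div_of_le hδ0 (by linarith)
    have t5 := mul_le_mul_of_nonneg_left t3 hM0
    have t6 := mul_le_mul_of_nonneg_right t4 hM'0
    have e : (M * (1 / c ^ 2) + M') / δ + (M * (1 / c + 1) / δ) * w ξ
        = M * (1 / (c ^ 2 * δ)) + M * (w ξ / (c * δ)) + (w ξ / δ * M + 1 / δ * M') := by
      field_simp
      ring
    calc ‖R ξ‖ = ‖((g ξ * p ξ : ℝ) : ℂ) + Complex.I * ((h' ξ * g ξ + h ξ * g' ξ : ℝ) : ℂ)‖ := by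
          simp only [R]; rw [norm_mul, nE, one_mul]
      _ ≤ _ := norm_add_le _ _
      _ ≤ _ := by rw [e]; linarith
  have hwint : ∫ ξ in a..b, w ξ ≤ Real.pi :=
    integral_abs_deriv_mul_div_sq_add_sq_le_pi hab hδ0 hF' hF'' hsign
  calc ‖∫ ξ in a..b, E ξ * g ξ‖ = ‖∫ ξ in a..b, R ξ‖ := by rw [heq]
    _ ≤ ∫ ξ in a..b, ‖R ξ‖ := intervalIntegral.norm_integral_le_integral_norm hab
    _ ≤ ∫ ξ in a..b, ((M * (1 / c ^ 2) + M') / δ + (M * (1 / c + 1) / δ) * w ξ) :=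
        intervalIntegral.integral_mono_on hab (cR.norm.intervalIntegrable _ _)
          ((by fun_prop : Continuous fun ξ =>
            (M * (1 / c ^ 2) + M') / δ + (M * (1 / c + 1) / δ) * w ξ).intervalIntegrable _ _)
          hbound
    _ = (b - a) * ((M * (1 / c ^ 2) + M') / δ) + (M * (1 / c + 1) / δ) * ∫ ξ in a..b, w ξ := by
        rw [intervalIntegral.integral_add (by simp) ((cw.const_mul _).intervalIntegrable _ _),
          intervalIntegral.integral_const, intervalIntegral.integral_const_mul, smul_eq_mul]
    _ ≤ (b - a) * ((M * (1 / c ^ 2) + M') / δ) + (M * (1 / c + 1) / δ) * Real.pi := by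
        gcongr
    _ = (M * (Real.pi / c + Real.pi) + (M * (1 / c ^ 2) + M') * (b - a)) / δ := by
        field_simp
        ring

/-- A continuous function without zeros on a preconnected set has constant sign there. -/
lemma IsPreconnected.nonneg_or_nonpos_of_ne_zero {s : Set ℝ} (hs : IsPreconnected s) {f : ℝ → ℝ}
    (hf : ContinuousOn f s) (h0 : ∀ ξ ∈ s, f ξ ≠ 0) :
    (∀ ξ ∈ s, 0 ≤ f ξ) ∨ ∀ ξ ∈ s, f ξ ≤ 0 := by
  by_contra! ⟨⟨y, hy, hfy⟩, z, hz, hfz⟩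
  obtain ⟨ξ, hξ, h⟩ := hs.intermediate_value hy hz hf ⟨hfy.le, hfz.le⟩
  exact h0 ξ hξ h

lemma half_abs_le_abs_add_mul_sub_mul {X t t' θ θ' r : ℝ} (ht' : |t'| ≤ 1) (hθ : |θ| ≤ 1)
    (hr : |θ - θ'| ≤ r) (ht : 4 * |t - t'| ≤ |X|) (hX : 4 * r ≤ |X|) :
    |X| / 2 ≤ |X + t * θ - t' * θ'| := by
  have h1 : |(t - t') * θ| ≤ |t - t'| := by
    rw [abs_mul]; exact mul_le_of_le_one_right (abs_nonneg _) hθ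
  have h2 : |t' * (θ - θ')| ≤ |θ - θ'| := by
    rw [abs_mul]; exact mul_le_of_le_one_left (abs_nonneg _) ht'
  have e : X = (X + t * θ - t' * θ') - ((t - t') * θ + t' * (θ - θ')) := by ring
  have h3 := abs_sub (X + t * θ - t' * θ') ((t - t') * θ + t' * (θ - θ'))
  rw [← e] at h3
  have h4 := abs_add_le ((t - t') * θ) (t' * (θ - θ'))
  linarith

/-- Where `A + s * u` is small compared with `D`, the second derivative of the phase is large. -/
lemma phase_derivative_dichotomy {A s l D K u v ξ : ℝ} (hl : 0 < l) (hK : 0 < K)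
    (hA : D / 2 ≤ |A|) (hD : 0 ≤ D) (hξ : |ξ| ≤ 2) (huv : K * |u| ≤ |l * ξ| * |v|) :
    min (1 / 4) (K / 8) * (l * D) ≤ |l * (A + s * u)| ∨
      min (1 / 4) (K / 8) * (l * D) ≤ |l ^ 2 * s * v| := by
  have hlD : 0 ≤ l * D := by positivity
  rcases le_total |s * u| (|A| / 2) with h | h
  · left
    have h1 : |A| - |s * u| ≤ |A + s * u| := by
      have := abs_sub_abs_le_abs_sub A (-(s * u))
      rwa [abs_neg, sub_neg_eq_add] at this
    calc min (1 / 4) (K / 8) * (l * D) ≤ 1 / 4 * (l * D) :=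
          mul_le_mul_of_nonneg_right (min_le_left _ _) hlD
      _ ≤ l * |A + s * u| := by nlinarith
      _ = _ := by rw [abs_mul, abs_of_pos hl]
  · right
    have h2 : K * |u| ≤ 2 * (l * |v|) := by
      refine huv.trans ?_
      rw [abs_mul, abs_of_pos hl]
      nlinarith [mul_nonneg hl.le (abs_nonneg v)]
    have h3 : K * |s * u| ≤ 2 * (l * |s| * |v|) := by
      rw [abs_mul]
      nlinarith [mul_le_mul_of_nonneg_left h2 (abs_nonneg s)]
    have h4 : K * (D / 4) ≤ 2 * (l * |s| * |v|) :=
      le_trans (mul_le_mul_of_nonneg_left (by linarith) hK.le) h3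
    calc min (1 / 4) (K / 8) * (l * D) ≤ K / 8 * (l * D) :=
          mul_le_mul_of_nonneg_right (min_le_right _ _) hlD
      _ ≤ l * (l * |s| * |v|) := by nlinarith
      _ = _ := by rw [abs_mul, abs_mul, abs_of_pos (by positivity : 0 < l ^ 2)]; ring

lemma integral_eq_add_of_support {f : ℝ → ℂ} (hf : Continuous f)
    (h : ∀ ξ, ξ ∉ Set.Ioo (-2 : ℝ) (-1/2) ∪ Set.Ioo (1/2 : ℝ) 2 → f ξ = 0) :
    ∫ ξ, f ξ = (∫ ξ in (-2 : ℝ)..(-1/2), f ξ) + ∫ ξ in (1/2 : ℝ)..2, f ξ := by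
  rw [intervalIntegral.integral_of_le (by norm_num), intervalIntegral.integral_of_le (by norm_num),
    ← setIntegral_union _ measurableSet_Ioc]
  · refine (setIntegral_eq_integral_of_forall_compl_eq_zero fun ξ hξ => h ξ fun h' => hξ ?_).symm
    exact Set.union_subset_union Set.Ioo_subset_Ioc_self Set.Ioo_subset_Ioc_self h'
  · exact (hf.intervalIntegrable (μ := volume) (-2) (-1/2)).1
  · exact (hf.intervalIntegrable (μ := volume) (1/2) 2).1
  · rw [Set.disjoint_left]
    rintro ξ ⟨_, h1⟩ ⟨h2, _⟩
    linarith


theorem statement9 (Φ : ℝ → ℝ) (hΦ : ContDiff ℝ 2 Φ)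
    (C₁ C₂ : ℝ) (hC₁ : 0 < C₁) (hC₂ : 0 < C₂)
    (hΦ1 : ∀ ξ : ℝ, 1 ≤ |ξ| → C₁ ≤ |ξ| * |deriv (deriv Φ) ξ|)
    (hΦ2 : ∀ ξ : ℝ, 1 ≤ |ξ| → C₂ * |deriv Φ ξ| ≤ |ξ| * |deriv (deriv Φ) ξ|)
    (ψ : ℝ → ℝ) (hψ : ContDiff ℝ (⊤ : ℕ∞) ψ) (hψc : HasCompactSupport ψ)
    (hψs : tsupport ψ ⊆ Set.Ioo (-2 : ℝ) (-1/2) ∪ Set.Ioo (1/2 : ℝ) 2)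
    (σ : ℝ) (hσ0 : 0 < σ) (hσ1 : σ ≤ 1) :
    ∃ C : ℝ, 0 < C ∧ ∀ k : ℕ, 1 ≤ k → ∀ x x' t t' θ θ' : ℝ,
      x ∈ Set.Ioo (-1 : ℝ) 1 → x' ∈ Set.Ioo (-1 : ℝ) 1 →
      t ∈ Set.Icc (-1 : ℝ) 1 → t' ∈ Set.Icc (-1 : ℝ) 1 →
      θ ∈ Set.Icc (-1 : ℝ) 1 → θ' ∈ Set.Icc (-1 : ℝ) 1 →
      |θ - θ'| ≤ ((2 : ℝ) ^ k) ^ (-σ) →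
      4 * |t - t'| ≤ |x - x'| → 4 * ((2 : ℝ) ^ k) ^ (-σ) ≤ |x - x'| →
      ‖∫ ξ : ℝ, Complex.exp (Complex.I *
            (((x - x' + t * θ - t' * θ') * ((2 : ℝ) ^ k * ξ) +
              (t - t') * Φ ((2 : ℝ) ^ k * ξ) : ℝ) : ℂ)) *
          ((ψ ξ : ℝ) : ℂ) ^ 2‖
        ≤ C * ((2 : ℝ) ^ k * |x - x'|) ^ (-(1 : ℝ) / 2) := by
  have dΦ : ∀ ξ, HasDerivAt Φ (deriv Φ ξ) ξ := fun ξ =>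
    (hΦ.differentiable (by norm_num) ξ).hasDerivAt
  have hΦ' : ContDiff ℝ 1 (deriv Φ) := hΦ.deriv'
  have dΦ' : ∀ ξ, HasDerivAt (deriv Φ) (deriv (deriv Φ) ξ) ξ := fun ξ =>
    (hΦ'.differentiable (by norm_num) ξ).hasDerivAt
  have cΦ'' : Continuous (deriv (deriv Φ)) := hΦ'.continuous_deriv (by norm_num)
  have hne : ∀ ξ : ℝ, 1 ≤ |ξ| → deriv (deriv Φ) ξ ≠ 0 := fun ξ hξ h => by
    have := hΦ1 ξ hξ
    rw [h] at this
    simp at this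
    linarith
  have dψ : ∀ ξ, HasDerivAt ψ (deriv ψ ξ) ξ := fun ξ =>
    (hψ.differentiable (by simp) ξ).hasDerivAt
  have cψ' : Continuous (deriv ψ) := hψ.continuous_deriv (by simp)
  have cψ : Continuous ψ := hψ.continuous
  have dg : ∀ ξ, HasDerivAt (fun y => ψ y ^ 2) (2 * ψ ξ * deriv ψ ξ) ξ := fun ξ => by
    simpa using (dψ ξ).fun_pow 2
  have cg' : Continuous fun ξ => 2 * ψ ξ * deriv ψ ξ := by fun_prop
  have hψ0 : ∀ ξ, ξ ∉ Set.Ioo (-2 : ℝ) (-1/2) ∪ Set.Ioo (1/2 : ℝ) 2 → ψ ξ = 0 := fun ξ hξ =>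
    image_eq_zero_of_notMem_tsupport fun h => hξ (hψs h)
  have sg : HasCompactSupport fun ξ => ψ ξ ^ 2 :=
    hψc.comp_left (g := fun y : ℝ => y ^ 2) (by norm_num)
  have sg' : HasCompactSupport fun ξ => 2 * ψ ξ * deriv ψ ξ :=
    (hψc.deriv (𝕜 := ℝ)).mul_left (f := fun ξ => 2 * ψ ξ)
  obtain ⟨M, hM⟩ : ∃ M, ∀ ξ, |ψ ξ ^ 2| ≤ M :=
    (by fun_prop : Continuous fun ξ => ψ ξ ^ 2).bounded_above_of_compact_support sg
  obtain ⟨M', hM'⟩ : ∃ M', ∀ ξ, |2 * ψ ξ * deriv ψ ξ| ≤ M' :=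
    cg'.bounded_above_of_compact_support sg'
  have hM0 : 0 ≤ M := (abs_nonneg _).trans (hM 0)
  have hM'0 : 0 ≤ M' := (abs_nonneg _).trans (hM' 0)
  set c : ℝ := min (1 / 4) (C₂ / 8) with hc
  have hc0 : 0 < c := by positivity
  have hpi := Real.pi_pos
  set B : ℝ := M * (Real.pi / c + Real.pi) + (M * (1 / c ^ 2) + M') * (3 / 2) with hB
  have hB0 : 0 ≤ B := by positivity
  refine ⟨2 * B + 1, by positivity, ?_⟩
  intro k hk x x' t t' θ θ' _ _ _ ht' hθ _ hθθ htx hxl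
  set l : ℝ := (2 : ℝ) ^ k with hl
  have hl2 : 2 ≤ l := by
    simpa using pow_le_pow_right₀ (by norm_num : (1 : ℝ) ≤ 2) hk
  set A : ℝ := x - x' + t * θ - t' * θ' with hA
  set s : ℝ := t - t' with hs
  have hAD : |x - x'| / 2 ≤ |A| :=
    half_abs_le_abs_add_mul_sub_mul (abs_le.2 ht') (abs_le.2 hθ) hθθ htx hxl
  have hlD : 1 ≤ l * |x - x'| := by
    have h1 : l ^ (-1 : ℝ) ≤ l ^ (-σ) :=
      Real.rpow_le_rpow_of_exponent_le (by linarith) (by linarith)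
    rw [Real.rpow_neg_one] at h1
    have h2 : l * l⁻¹ ≤ l * |x - x'| :=
      mul_le_mul_of_nonneg_left
        (by have := inv_nonneg.2 (by linarith : (0 : ℝ) ≤ l); linarith) (by linarith)
    rwa [mul_inv_cancel₀ (by linarith)] at h2
  set δ : ℝ := √(l * |x - x'|) with hδ
  have hδ1 : 1 ≤ δ := Real.one_le_sqrt.2 hlD
  have hδ2 : δ ^ 2 = l * |x - x'| := Real.sq_sqrt (by linarith)
  have hpow : (l * |x - x'|) ^ (-(1 : ℝ) / 2) = 1 / δ := by
    rw [neg_div, Real.rpow_neg (by linarith), ← Real.sqrt_eq_rpow, one_div]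
  have dlin : ∀ ξ, HasDerivAt (fun y => l * y) l ξ := fun ξ => by
    simpa using (hasDerivAt_id ξ).const_mul l
  have dF : ∀ ξ, HasDerivAt (fun y => A * (l * y) + s * Φ (l * y))
      (l * (A + s * deriv Φ (l * ξ))) ξ := fun ξ => by
    refine (((dlin ξ).const_mul A).fun_add
      (((dΦ (l * ξ)).comp ξ (dlin ξ)).const_mul s)).congr_deriv ?_
    ring
  have dF' : ∀ ξ, HasDerivAt (fun y => l * (A + s * deriv Φ (l * y)))
      (l ^ 2 * s * deriv (deriv Φ) (l * ξ)) ξ := fun ξ => by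
    refine (((((dΦ' (l * ξ)).comp ξ (dlin ξ)).const_mul s).const_add A).const_mul l).congr_deriv ?_
    ring
  have cF'' : Continuous fun ξ => l ^ 2 * s * deriv (deriv Φ) (l * ξ) := by fun_prop
  have key : ∀ a b : ℝ, a ≤ b → b - a = 3 / 2 → ψ a = 0 → ψ b = 0 →
      (∀ ξ ∈ Set.Icc a b, 1 / 2 ≤ |ξ| ∧ |ξ| ≤ 2) →
      ‖∫ ξ in a..b, Complex.exp (Complex.I * ((A * (l * ξ) + s * Φ (l * ξ) : ℝ) : ℂ)) *
        ((ψ ξ ^ 2 : ℝ) : ℂ)‖ ≤ B / δ := by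
    intro a b hab hlen ha hb hI
    have h1 : ∀ ξ ∈ Set.Icc a b, 1 ≤ |l * ξ| := fun ξ hξ => by
      rw [abs_mul, abs_of_pos (by linarith : 0 < l)]
      nlinarith [(hI ξ hξ).1]
    have hsign : (∀ ξ ∈ Set.Icc a b, 0 ≤ l ^ 2 * s * deriv (deriv Φ) (l * ξ)) ∨
        ∀ ξ ∈ Set.Icc a b, l ^ 2 * s * deriv (deriv Φ) (l * ξ) ≤ 0 := by
      rcases eq_or_ne s 0 with h0 | h0
      · simp [h0]
      · exact isPreconnected_Icc.nonneg_or_nonpos_of_ne_zero cF''.continuousOn fun ξ hξ =>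
          mul_ne_zero (mul_ne_zero (by positivity) h0) (hne _ (h1 ξ hξ))
    rw [hB, ← hlen]
    refine norm_integral_exp_mul_le_div hab hc0 hδ1 dF dF' cF'' dg cg' (by simp [ha]) (by simp [hb])
      hM hM' hsign fun ξ hξ => ?_
    rw [hδ2]
    exact phase_derivative_dichotomy (by linarith) hC₂ hAD (abs_nonneg _) (hI ξ hξ).2
      (hΦ2 _ (h1 ξ hξ))
  have cF : Continuous fun ξ => A * (l * ξ) + s * Φ (l * ξ) := by
    have := hΦ.continuous
    fun_prop
  have hsplit := integral_eq_add_of_support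
    (f := fun ξ => Complex.exp (Complex.I * ((A * (l * ξ) + s * Φ (l * ξ) : ℝ) : ℂ)) *
      ((ψ ξ ^ 2 : ℝ) : ℂ)) (by fun_prop) fun ξ hξ => by simp [hψ0 ξ hξ]
  have hneg := key (-2) (-1/2) (by norm_num) (by norm_num) (hψ0 _ (by norm_num))
    (hψ0 _ (by norm_num)) fun ξ hξ => by
      rw [abs_of_nonpos (by linarith [hξ.2])]
      constructor <;> linarith [hξ.1, hξ.2]
  have hposi := key (1/2) 2 (by norm_num) (by norm_num) (hψ0 _ (by norm_num))
    (hψ0 _ (by norm_num)) fun ξ hξ => by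
      rw [abs_of_nonneg (by linarith [hξ.1])]
      exact hξ
  rw [hpow]
  simp only [Complex.ofReal_pow] at hsplit hneg hposi
  rw [hsplit]
  refine (norm_add_le _ _).trans ?_
  have : 0 ≤ 1 / δ := by positivity
  have e : (2 * B + 1) * (1 / δ) = B / δ + B / δ + 1 / δ := by ring
  rw [e]
  linarith
end

section
/- Let Φ ∈ C²(ℝ) satisfy |ξ||Φ''(ξ)| ≥ C₁ > 0 for all |ξ| ≥ 1, and suppose Φ' is monotone on [1,∞) and on (-∞,-1]. Let ψ ∈ C_0^∞(ℝ) be supported in (-2,-1/2) ∪ (1/2,2), let λ ≥ 2, and let η, τ ∈ ℝ. Set U₁ = {ξ ∈ ℝ : |η| ≥ 2|τ||Φ'(λξ)|}. If λ|η| ≥ 4, then |∫_{U₁} e^{i(ηλξ + τΦ(λξ))} ψ(ξ)² dξ| ≤ C (λ|η|)^{−1} for a constant C depending only on ψ; in particular, on U₁ ∩ supp ψ the phase derivative satisfies |λη + λτΦ'(λξ)| ≥ (λ/2)|η|. -/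
/-- Non-stationary phase bound: if the phase `p` has derivative `q` with `L ≤ |q|` on `[a, b]`, and
`q' = r` has constant sign there, then `∫ exp (i p) F` is `O(1 / L)`. -/
theorem norm_integral_exp_mul_le_of_le_abs_deriv {a b L M M' s : ℝ} {p q r F F' : ℝ → ℝ}
    (hab : a ≤ b) (hL : 0 < L)
    (hp : ∀ x, HasDerivAt p (q x) x) (hq : ∀ x, HasDerivAt q (r x) x) (hr : Continuous r)
    (hF : ∀ x, HasDerivAt F (F' x) x) (hF' : Continuous F')
    (hs : |s| = 1) (hsr : ∀ x ∈ Set.Icc a b, 0 ≤ s * r x)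
    (hLq : ∀ x ∈ Set.Icc a b, L ≤ |q x|)
    (hM : ∀ x, |F x| ≤ M) (hM' : ∀ x, |F' x| ≤ M') :
    ‖∫ x in a..b, Complex.exp (Complex.I * (p x : ℂ)) * (F x : ℂ)‖
      ≤ (4 * M + M' * (b - a)) / L := by
  have hpc : Continuous p := continuous_iff_continuousAt.2 fun x => (hp x).continuousAt
  have hqc : Continuous q := continuous_iff_continuousAt.2 fun x => (hq x).continuousAt
  have hFc : Continuous F := continuous_iff_continuousAt.2 fun x => (hF x).continuousAt
  have hM0 : 0 ≤ M := (abs_nonneg _).trans (hM 0)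
  have hM0' : 0 ≤ M' := (abs_nonneg _).trans (hM' 0)
  have hq0 : ∀ x ∈ Set.Icc a b, q x ≠ 0 := fun x hx =>
    abs_pos.1 (hL.trans_le (hLq x hx))
  have hinv : ∀ x ∈ Set.Icc a b, |(q x)⁻¹| ≤ L⁻¹ := fun x hx => by
    rw [abs_inv]
    exact inv_anti₀ hL (hLq x hx)
  have huIcc : Set.uIcc a b = Set.Icc a b := Set.uIcc_of_le hab
  set E : ℝ → ℂ := fun x => Complex.exp (Complex.I * (p x : ℂ)) with hE
  have hEc : Continuous E := by fun_prop
  have hEn : ∀ x, ‖E x‖ = 1 := fun x => by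
    simp only [hE]
    rw [mul_comm]
    exact Complex.norm_exp_ofReal_mul_I _
  set A : ℝ → ℝ := fun x => F x * (q x)⁻¹ with hA
  set A' : ℝ → ℝ := fun x => F' x * (q x)⁻¹ + F x * (-r x / q x ^ 2) with hA'
  have hAd : ∀ x ∈ Set.Icc a b, HasDerivAt A (A' x) x := fun x hx =>
    (hF x).mul ((hq x).inv (hq0 x hx))
  have hAc' : ContinuousOn A' (Set.Icc a b) := by
    refine (hF'.continuousOn.mul (hqc.continuousOn.inv₀ hq0)).add
      (hFc.continuousOn.mul (hr.neg.continuousOn.div (hqc.pow 2).continuousOn fun x hx => ?_))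
    exact pow_ne_zero 2 (hq0 x hx)
  have hEd : ∀ x, HasDerivAt E (E x * (Complex.I * (q x : ℂ))) x := fun x =>
    ((hp x).ofReal_comp.const_mul Complex.I).cexp
  have hparts : ∫ x in a..b, (A x : ℂ) * (E x * (Complex.I * (q x : ℂ))) =
      (A b : ℂ) * E b - (A a : ℂ) * E a - ∫ x in a..b, (A' x : ℂ) * E x := by
    refine intervalIntegral.integral_mul_deriv_eq_deriv_mul
      (u := fun x => (A x : ℂ)) (u' := fun x => (A' x : ℂ)) (fun x hx => ?_) (fun x _ => hEd x) ?_ ?_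
    · exact (hAd x (huIcc ▸ hx)).ofReal_comp
    · refine ContinuousOn.intervalIntegrable ?_
      rw [huIcc]
      exact Complex.continuous_ofReal.comp_continuousOn hAc'
    · exact Continuous.intervalIntegrable (by fun_prop) _ _
  have hlhs : ∫ x in a..b, (A x : ℂ) * (E x * (Complex.I * (q x : ℂ))) =
      Complex.I * ∫ x in a..b, E x * (F x : ℂ) := by
    rw [← intervalIntegral.integral_const_mul]
    refine intervalIntegral.integral_congr fun x hx => ?_
    have h0 : (q x : ℂ) ≠ 0 := by exact_mod_cast hq0 x (huIcc ▸ hx)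
    simp only [hA]
    push_cast
    field_simp
  have hAb : ∀ x ∈ Set.Icc a b, ‖(A x : ℂ) * E x‖ ≤ M * L⁻¹ := fun x hx => by
    rw [norm_mul, hEn, mul_one, Complex.norm_real, Real.norm_eq_abs, hA, abs_mul]
    exact mul_le_mul (hM x) (hinv x hx) (abs_nonneg _) hM0
  have hcr : ContinuousOn (fun x => -r x / q x ^ 2) (Set.uIcc a b) := by
    rw [huIcc]
    exact hr.neg.continuousOn.div (hqc.pow 2).continuousOn fun x hx => pow_ne_zero 2 (hq0 x hx)
  have hFTC : ∫ x in a..b, -r x / q x ^ 2 = (q b)⁻¹ - (q a)⁻¹ :=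
    intervalIntegral.integral_eq_sub_of_hasDerivAt (f := fun x => (q x)⁻¹)
      (fun x hx => (hq x).inv (hq0 x (huIcc ▸ hx))) hcr.intervalIntegrable
  have hrest : ‖∫ x in a..b, (A' x : ℂ) * E x‖ ≤
      ∫ x in a..b, (M' * L⁻¹ + M * -s * (-r x / q x ^ 2)) := by
    refine intervalIntegral.norm_integral_le_of_norm_le hab (Filter.Eventually.of_forall ?_) ?_
    · intro x hx
      have hx' := Set.Ioc_subset_Icc_self hx
      rw [norm_mul, hEn, mul_one, Complex.norm_real, Real.norm_eq_abs]
      refine (abs_add_le _ _).trans (add_le_add ?_ ?_)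
      · rw [abs_mul]
        exact mul_le_mul (hM' x) (hinv x hx') (abs_nonneg _) hM0'
      · have h1 : |-r x / q x ^ 2| = -s * (-r x / q x ^ 2) := by
          have h2 : |r x| = s * r x := by
            rw [← abs_of_nonneg (hsr x hx'), abs_mul, hs, one_mul]
          rw [abs_div, abs_neg, h2, abs_of_nonneg (sq_nonneg (q x))]
          ring
        rw [abs_mul, mul_assoc, ← h1]
        exact mul_le_mul_of_nonneg_right (hM x) (abs_nonneg _)
    · exact intervalIntegrable_const.add (hcr.intervalIntegrable.const_mul _)
  rw [intervalIntegral.integral_add intervalIntegrable_const (hcr.intervalIntegrable.const_mul _),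
    intervalIntegral.integral_const, smul_eq_mul, intervalIntegral.integral_const_mul, hFTC]
    at hrest
  have ha := Set.left_mem_Icc.2 hab
  have hb := Set.right_mem_Icc.2 hab
  have hbd : M * -s * ((q b)⁻¹ - (q a)⁻¹) ≤ M * (2 * L⁻¹) := by
    rw [mul_assoc]
    refine mul_le_mul_of_nonneg_left ((le_abs_self _).trans ?_) hM0
    rw [abs_mul, abs_neg, hs, one_mul]
    linarith [abs_sub (q b)⁻¹ (q a)⁻¹, hinv a ha, hinv b hb]
  have hkey : ‖∫ x in a..b, E x * (F x : ℂ)‖ =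
      ‖(A b : ℂ) * E b - (A a : ℂ) * E a - ∫ x in a..b, (A' x : ℂ) * E x‖ := by
    rw [← hparts, hlhs, norm_mul, Complex.norm_I, one_mul]
  refine hkey.trans_le ?_
  rw [div_eq_mul_inv]
  have h1 := norm_sub_le ((A b : ℂ) * E b - (A a : ℂ) * E a) (∫ x in a..b, (A' x : ℂ) * E x)
  have h2 := norm_sub_le ((A b : ℂ) * E b) ((A a : ℂ) * E a)
  have h3 := hAb a ha
  have h4 := hAb b hb
  nlinarith

/-- A sublevel set of `|g|` inside a compact interval is empty or a compact interval when `g` is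
continuous and monotone or antitone there. -/
theorem setOf_mul_abs_le_inter_Icc_eq_empty_or_Icc {g : ℝ → ℝ} {c d k m : ℝ} (hg : Continuous g)
    (hk : 0 ≤ k) (hmono : MonotoneOn g (Set.Icc c d) ∨ AntitoneOn g (Set.Icc c d)) :
    {x | k * |g x| ≤ m} ∩ Set.Icc c d = ∅ ∨
      ∃ a b, a ≤ b ∧ {x | k * |g x| ≤ m} ∩ Set.Icc c d = Set.Icc a b := by
  set S := {x | k * |g x| ≤ m} ∩ Set.Icc c d with hS
  rcases S.eq_empty_or_nonempty with h | hne
  · exact Or.inl h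
  right
  have hcpt : IsCompact S :=
    isCompact_Icc.inter_left (isClosed_le (by fun_prop) continuous_const)
  have hord : S.OrdConnected := by
    refine ⟨fun x hx y hy z hz => ?_⟩
    have hzI : z ∈ Set.Icc c d := ⟨hx.2.1.trans hz.1, hz.2.trans hy.2.2⟩
    refine ⟨?_, hzI⟩
    have hmax : |g z| ≤ max |g x| |g y| := by
      rcases hmono with h | h
      · exact abs_le_max_abs_abs (h hx.2 hzI hz.1) (h hzI hy.2 hz.2)
      · rw [max_comm]
        exact abs_le_max_abs_abs (h hzI hy.2 hz.2) (h hx.2 hzI hz.1)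
    refine (mul_le_mul_of_nonneg_left hmax hk).trans ?_
    rcases max_choice |g x| |g y| with h | h <;> rw [h]
    exacts [hx.1, hy.1]
  have heq := eq_Icc_of_connected_compact ⟨hne, hord.isPreconnected⟩ hcpt
  refine ⟨sInf S, sSup S, ?_, heq⟩
  rw [heq] at hne
  exact Set.nonempty_Icc.1 hne

/-- If `2 |τ| |y| ≤ |η|` then `lam (η + τ y)` is at least half as large as `lam η`. -/
theorem half_mul_abs_le_abs_add {lam η τ y : ℝ} (hlam : 0 ≤ lam) (h : 2 * |τ| * |y| ≤ |η|) :
    lam / 2 * |η| ≤ |lam * η + lam * τ * y| := by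
  have h1 : lam * η + lam * τ * y = lam * (η - -(τ * y)) := by ring
  have h2 := abs_sub_abs_le_abs_sub η (-(τ * y))
  rw [abs_neg, abs_mul] at h2
  rw [h1, abs_mul, abs_of_nonneg hlam]
  nlinarith

/-- The derivative of a differentiable function that is monotone or antitone on a set with unique
derivatives has constant sign there, also after multiplication by a constant. -/
theorem exists_abs_eq_one_forall_nonneg_mul_deriv {g : ℝ → ℝ} {s : Set ℝ} (hg : Differentiable ℝ g)
    (hs : UniqueDiffOn ℝ s) (hmono : MonotoneOn g s ∨ AntitoneOn g s) (τ : ℝ) :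
    ∃ ε : ℝ, |ε| = 1 ∧ ∀ x ∈ s, 0 ≤ ε * (τ * deriv g x) := by
  have hd : ∀ x ∈ s, derivWithin g s x = deriv g x := fun x hx =>
    (hg x).derivWithin (hs x hx)
  obtain ⟨δ, hδ, h⟩ : ∃ δ : ℝ, |δ| = 1 ∧ ∀ x ∈ s, 0 ≤ δ * deriv g x := by
    rcases hmono with h | h
    · refine ⟨1, abs_one, fun x hx => ?_⟩
      rw [one_mul, ← hd x hx]
      exact h.derivWithin_nonneg
    · refine ⟨-1, by norm_num, fun x hx => ?_⟩
      rw [← hd x hx]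
      have : derivWithin g s x ≤ 0 := h.derivWithin_nonpos
      linarith
  rcases le_total 0 τ with hτ | hτ
  · refine ⟨δ, hδ, fun x hx => ?_⟩
    have := mul_nonneg hτ (h x hx)
    linarith
  · refine ⟨-δ, by rwa [abs_neg], fun x hx => ?_⟩
    have := mul_nonneg (neg_nonneg.2 hτ) (h x hx)
    linarith

/-- The non-stationary phase bound on the part of `{2 |τ| |Φ'(lam ξ)| ≤ |η|}` in an interval
`[c, d]` whose dilate lies in a set `s` where `Φ'` is monotone or antitone. -/
theorem norm_setIntegral_exp_mul_le {Φ F F' : ℝ → ℝ} {c d lam η τ M M' : ℝ} {s : Set ℝ}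
    (hΦ : ContDiff ℝ 2 Φ) (hs : UniqueDiffOn ℝ s)
    (hmono : MonotoneOn (deriv Φ) s ∨ AntitoneOn (deriv Φ) s)
    (hlam : 0 < lam) (hη : 0 < |η|) (hcd : c ≤ d) (hmaps : ∀ x ∈ Set.Icc c d, lam * x ∈ s)
    (hF : ∀ x, HasDerivAt F (F' x) x) (hF' : Continuous F')
    (hM : ∀ x, |F x| ≤ M) (hM' : ∀ x, |F' x| ≤ M') :
    ‖∫ ξ in {ξ : ℝ | 2 * |τ| * |deriv Φ (lam * ξ)| ≤ |η|} ∩ Set.Icc c d,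
        Complex.exp (Complex.I * ((η * (lam * ξ) + τ * Φ (lam * ξ) : ℝ) : ℂ)) * (F ξ : ℂ)‖
      ≤ 2 * (4 * M + M' * (d - c)) * (lam * |η|)⁻¹ := by
  have hM0 : 0 ≤ M := (abs_nonneg _).trans (hM 0)
  have hM0' : 0 ≤ M' := (abs_nonneg _).trans (hM' 0)
  have hΦd : Differentiable ℝ Φ := hΦ.differentiable (by norm_num)
  have hΦ1 : ContDiff ℝ 1 (deriv Φ) :=
    ((contDiff_succ_iff_deriv (n := 1)).1 (by simpa [one_add_one_eq_two] using hΦ)).2.2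
  have hgd : Differentiable ℝ (deriv Φ) := hΦ1.differentiable (by norm_num)
  have hgc : Continuous (deriv (deriv Φ)) := hΦ1.continuous_deriv le_rfl
  have hmono' : MonotoneOn (fun x => deriv Φ (lam * x)) (Set.Icc c d) ∨
      AntitoneOn (fun x => deriv Φ (lam * x)) (Set.Icc c d) :=
    hmono.imp
      (fun h x hx y hy hxy => h (hmaps x hx) (hmaps y hy) (mul_le_mul_of_nonneg_left hxy hlam.le))
      (fun h x hx y hy hxy => h (hmaps x hx) (hmaps y hy) (mul_le_mul_of_nonneg_left hxy hlam.le))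
  have hgcont : Continuous fun x => deriv Φ (lam * x) :=
    hgd.continuous.comp (continuous_const.mul continuous_id)
  have hrhs : 0 ≤ 2 * (4 * M + M' * (d - c)) * (lam * |η|)⁻¹ := by
    have := sub_nonneg.2 hcd
    positivity
  rcases setOf_mul_abs_le_inter_Icc_eq_empty_or_Icc (k := 2 * |τ|) (m := |η|) hgcont
    (by positivity) hmono' with h | ⟨a, b, hab, h⟩
  · rw [h]
    simpa using hrhs
  have hsub : ∀ x ∈ Set.Icc a b, 2 * |τ| * |deriv Φ (lam * x)| ≤ |η| ∧ x ∈ Set.Icc c d :=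
    fun x hx => by
      rw [← h] at hx
      exact hx
  obtain ⟨ε, hε, hsign⟩ := exists_abs_eq_one_forall_nonneg_mul_deriv hgd hs hmono τ
  have hlin : ∀ x, HasDerivAt (fun x : ℝ => lam * x) lam x := fun x => by
    simpa using (hasDerivAt_id x).const_mul lam
  have hmain := norm_integral_exp_mul_le_of_le_abs_deriv
    (p := fun x => η * (lam * x) + τ * Φ (lam * x))
    (q := fun x => lam * η + lam * τ * deriv Φ (lam * x))
    (r := fun x => lam ^ 2 * (τ * deriv (deriv Φ) (lam * x)))
    (F := F) (F' := F') (L := lam / 2 * |η|) (s := ε) hab (by positivity)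
    (fun x => by
      have h1 : HasDerivAt (fun x => Φ (lam * x)) (deriv Φ (lam * x) * lam) x :=
        (hΦd (lam * x)).hasDerivAt.comp x (hlin x)
      exact (((hlin x).const_mul η).add (h1.const_mul τ)).congr_deriv (by ring))
    (fun x => by
      have h1 : HasDerivAt (fun x => deriv Φ (lam * x)) (deriv (deriv Φ) (lam * x) * lam) x :=
        (hgd (lam * x)).hasDerivAt.comp x (hlin x)
      exact ((h1.const_mul (lam * τ)).const_add (lam * η)).congr_deriv (by ring))
    (by fun_prop) hF hF' hε
    (fun x hx => by
      have := mul_nonneg (sq_nonneg lam) (hsign _ (hmaps x (hsub x hx).2))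
      linarith)
    (fun x hx => half_mul_abs_le_abs_add hlam.le (hsub x hx).1) hM hM'
  rw [h, MeasureTheory.integral_Icc_eq_integral_Ioc, ← intervalIntegral.integral_of_le hab]
  refine hmain.trans ?_
  have hba : b - a ≤ d - c :=
    sub_le_sub (hsub b (Set.right_mem_Icc.2 hab)).2.2 (hsub a (Set.left_mem_Icc.2 hab)).2.1
  calc (4 * M + M' * (b - a)) / (lam / 2 * |η|)
      ≤ (4 * M + M' * (d - c)) / (lam / 2 * |η|) := by gcongr
    _ = 2 * (4 * M + M' * (d - c)) * (lam * |η|)⁻¹ := by field_simp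

theorem statement10 (ψ : ℝ → ℝ) (hψ : ContDiff ℝ (⊤ : ℕ∞) ψ) (hψc : HasCompactSupport ψ)
    (hψs : tsupport ψ ⊆ Set.Ioo (-2 : ℝ) (-1/2) ∪ Set.Ioo (1/2 : ℝ) 2) :
    ∃ C : ℝ, 0 < C ∧
      ∀ Φ : ℝ → ℝ, ContDiff ℝ 2 Φ →
      ∀ C₁ : ℝ, 0 < C₁ →
      (∀ ξ : ℝ, 1 ≤ |ξ| → C₁ ≤ |ξ| * |deriv (deriv Φ) ξ|) →
      (MonotoneOn (deriv Φ) (Set.Ici (1 : ℝ)) ∨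
        AntitoneOn (deriv Φ) (Set.Ici (1 : ℝ))) →
      (MonotoneOn (deriv Φ) (Set.Iic (-1 : ℝ)) ∨
        AntitoneOn (deriv Φ) (Set.Iic (-1 : ℝ))) →
      ∀ lam η τ : ℝ, 2 ≤ lam → 4 ≤ lam * |η| →
      (‖∫ ξ in {ξ : ℝ | 2 * |τ| * |deriv Φ (lam * ξ)| ≤ |η|},
          Complex.exp (Complex.I * ((η * (lam * ξ) + τ * Φ (lam * ξ) : ℝ) : ℂ)) *
            ((ψ ξ : ℝ) : ℂ) ^ 2‖
        ≤ C * (lam * |η|)⁻¹) ∧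
      (∀ ξ : ℝ, ξ ∈ {ξ : ℝ | 2 * |τ| * |deriv Φ (lam * ξ)| ≤ |η|} ∩ tsupport ψ →
        (lam / 2) * |η| ≤ |lam * η + lam * τ * deriv Φ (lam * ξ)|) := by
  set F : ℝ → ℝ := fun x => ψ x ^ 2 with hFdef
  have hFsm : ContDiff ℝ 1 F := (hψ.of_le (by exact_mod_cast le_top)).pow 2
  have hFcs : HasCompactSupport F := hψc.comp_left (g := fun y : ℝ => y ^ 2) (by norm_num)
  have hFd : ∀ x, HasDerivAt F (deriv F x) x := fun x =>
    (hFsm.differentiable (by norm_num) x).hasDerivAt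
  have hFc' : Continuous (deriv F) := hFsm.continuous_deriv le_rfl
  obtain ⟨M, hM⟩ := hFsm.continuous.bounded_above_of_compact_support hFcs
  obtain ⟨M', hM'⟩ := hFc'.bounded_above_of_compact_support hFcs.deriv
  have hM0 : 0 ≤ M := (norm_nonneg _).trans (hM 0)
  have hM0' : 0 ≤ M' := (norm_nonneg _).trans (hM' 0)
  refine ⟨4 * (4 * M + M' * (3 / 2)) + 1, by positivity, ?_⟩
  intro Φ hΦ C₁ _ _ hpos hneg lam η τ hlam hη
  have hlam0 : 0 < lam := by linarith
  have hη0 : 0 < |η| := by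
    by_contra hcon
    have := mul_nonpos_of_nonneg_of_nonpos hlam0.le (not_lt.1 hcon)
    linarith
  refine ⟨?_, fun ξ hξ => half_mul_abs_le_abs_add hlam0.le hξ.1⟩
  have hP := norm_setIntegral_exp_mul_le (c := 1 / 2) (d := 2) (τ := τ) hΦ (uniqueDiffOn_Ici 1) hpos
    hlam0 hη0 (by norm_num) (fun x hx => by simp only [Set.mem_Ici]; nlinarith [hx.1]) hFd hFc' hM hM'
  have hN := norm_setIntegral_exp_mul_le (c := -2) (d := -1 / 2) (τ := τ) hΦ (uniqueDiffOn_Iic (-1))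
    hneg hlam0 hη0 (by norm_num) (fun x hx => by simp only [Set.mem_Iic]; nlinarith [hx.2])
    hFd hFc' hM hM'
  set U := {ξ : ℝ | 2 * |τ| * |deriv Φ (lam * ξ)| ≤ |η|} with hU
  have hΦc : Continuous Φ := hΦ.continuous
  have hgc : Continuous (deriv Φ) := hΦ.continuous_deriv (by norm_num)
  have hUm : MeasurableSet U :=
    (isClosed_le (by fun_prop) continuous_const).measurableSet
  set f : ℝ → ℂ := fun ξ =>
    Complex.exp (Complex.I * ((η * (lam * ξ) + τ * Φ (lam * ξ) : ℝ) : ℂ)) * (F ξ : ℂ) with hf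
  have hfc : Continuous f := by
    have := hFsm.continuous
    fun_prop
  have hint : ∀ c d : ℝ, MeasureTheory.IntegrableOn f (U ∩ Set.Icc c d) := fun c d =>
    (hfc.integrableOn_Icc).mono_set Set.inter_subset_right
  have hsplit : ∫ ξ in U, f ξ =
      (∫ ξ in U ∩ Set.Icc (-2) (-1 / 2), f ξ) + ∫ ξ in U ∩ Set.Icc (1 / 2) 2, f ξ := by
    rw [← MeasureTheory.setIntegral_union ?_ (hUm.inter measurableSet_Icc) (hint _ _) (hint _ _)]
    · refine MeasureTheory.setIntegral_eq_of_subset_of_forall_sdiff_eq_zero (f := f) hUm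
        (Set.union_subset Set.inter_subset_left Set.inter_subset_left) fun x hx => ?_
      have hψ0 : ψ x = 0 := by
        by_contra hne
        refine hx.2 ?_
        rcases hψs (subset_tsupport ψ hne) with h | h
        · exact Or.inl ⟨hx.1, Set.Ioo_subset_Icc_self h⟩
        · exact Or.inr ⟨hx.1, Set.Ioo_subset_Icc_self h⟩
      simp [hf, hFdef, hψ0]
    · rw [Set.disjoint_left]
      rintro x ⟨-, hx⟩ ⟨-, hx'⟩
      linarith [hx.2, hx'.1]
  have hgoal : ∫ ξ in U, Complex.exp (Complex.I * ((η * (lam * ξ) + τ * Φ (lam * ξ) : ℝ) : ℂ)) *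
      ((ψ ξ : ℝ) : ℂ) ^ 2 = ∫ ξ in U, f ξ := by
    simp only [hf, hFdef, Complex.ofReal_pow]
  rw [hgoal, hsplit]
  refine (norm_add_le _ _).trans ((add_le_add hN hP).trans ?_)
  have : 0 ≤ (lam * |η|)⁻¹ := by positivity
  linarith
end

section
/- Let Φ ∈ C²(ℝ) satisfy |ξ||Φ''(ξ)| ≥ C₂|Φ'(ξ)| for all |ξ| ≥ 1, for some constant C₂ > 0. Let ψ ∈ C_0^∞(ℝ) be supported in (-2,-1/2) ∪ (1/2,2), let λ ≥ 2, and let η, τ ∈ ℝ with η ≠ 0. Set U₂ = {ξ ∈ ℝ : |η| < 2|τ||Φ'(λξ)|}. Then for every ξ ∈ U₂ with 1/2 ≤ |ξ| ≤ 2 one has λ²|τ||Φ''(λξ)| ≥ (C₂/4)λ|η|, and consequently |∫_{U₂} e^{i(ηλξ + τΦ(λξ))} ψ(ξ)² dξ| ≤ C (λ|η|)^{−1/2} for a constant C depending only on ψ and C₂. -/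
open MeasureTheory Set

theorem continuous_cexp_I_mul {φ : ℝ → ℝ} (hφ : Continuous φ) :
    Continuous fun x => Complex.exp (Complex.I * (φ x : ℂ)) := by
  fun_prop

theorem norm_integral_cexp_le_sub {φ : ℝ → ℝ} {a b : ℝ} (hab : a ≤ b) :
    ‖∫ x in a..b, Complex.exp (Complex.I * (φ x : ℂ))‖ ≤ b - a := by
  have h := intervalIntegral.norm_integral_le_of_norm_le_const (a := a) (b := b) (C := 1)
    (f := fun x => Complex.exp (Complex.I * (φ x : ℂ)))
    (fun x _ => (Complex.norm_exp_I_mul_ofReal (φ x)).le)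
  rwa [one_mul, abs_of_nonneg (sub_nonneg.2 hab)] at h

/-- Van der Corput's first derivative test. -/
theorem norm_integral_cexp_le_of_le_deriv {φ p q : ℝ → ℝ} {a b ν : ℝ} (hab : a ≤ b)
    (hφ : ∀ x, HasDerivAt φ (p x) x) (hp : ∀ x, HasDerivAt p (q x) x) (hq : Continuous q)
    (hν : 0 < ν) (hpν : ∀ x ∈ Icc a b, ν ≤ p x) (hq0 : ∀ x ∈ Icc a b, 0 ≤ q x) :
    ‖∫ x in a..b, Complex.exp (Complex.I * (φ x : ℂ))‖ ≤ 2 / ν := by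
  have hφc : Continuous φ := continuous_iff_continuousAt.2 fun x => (hφ x).continuousAt
  have hpc : Continuous p := continuous_iff_continuousAt.2 fun x => (hp x).continuousAt
  have hppos : ∀ x ∈ Icc a b, 0 < p x := fun x hx => hν.trans_le (hpν x hx)
  have hec := continuous_cexp_I_mul hφc
  have hr : ∀ x ∈ uIcc a b, HasDerivAt (fun x => (p x)⁻¹) (-q x / p x ^ 2) x := by
    intro x hx
    rw [uIcc_of_le hab] at hx
    exact (hp x).inv (hppos x hx).ne'
  have hrc : ContinuousOn (fun x => -q x / p x ^ 2) (uIcc a b) := by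
    rw [uIcc_of_le hab]
    exact hq.neg.continuousOn.div (hpc.pow 2).continuousOn
      fun x hx => (pow_pos (hppos x hx) 2).ne'
  have hv : ∀ x ∈ uIcc a b, HasDerivAt (fun x => Complex.exp (Complex.I * (φ x : ℂ)))
      (Complex.exp (Complex.I * (φ x : ℂ)) * (Complex.I * (p x : ℂ))) x := fun x _ =>
    ((hφ x).ofReal_comp.const_mul Complex.I).cexp
  have hu : ∀ x ∈ uIcc a b, HasDerivAt (fun x => -Complex.I * (((p x)⁻¹ : ℝ) : ℂ))
      (-Complex.I * ((-q x / p x ^ 2 : ℝ) : ℂ)) x := fun x hx =>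
    (hr x hx).ofReal_comp.const_mul _
  have hparts := intervalIntegral.integral_mul_deriv_eq_deriv_mul hu hv
    (ContinuousOn.intervalIntegrable
      (continuousOn_const.mul (Complex.continuous_ofReal.comp_continuousOn hrc)))
    (Continuous.intervalIntegrable
      (hec.mul (continuous_const.mul (Complex.continuous_ofReal.comp hpc))) _ _)
  have hcongr : ∫ x in a..b, Complex.exp (Complex.I * (φ x : ℂ)) =
      ∫ x in a..b, -Complex.I * (((p x)⁻¹ : ℝ) : ℂ) *
        (Complex.exp (Complex.I * (φ x : ℂ)) * (Complex.I * (p x : ℂ))) := by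
    refine intervalIntegral.integral_congr fun x hx => ?_
    rw [uIcc_of_le hab] at hx
    have hne : (p x : ℂ) ≠ 0 := by exact_mod_cast (hppos x hx).ne'
    have hI := Complex.I_mul_I
    push_cast
    field_simp
    linear_combination hI
  have hbd : ‖∫ x in a..b, -Complex.I * ((-q x / p x ^ 2 : ℝ) : ℂ) *
      Complex.exp (Complex.I * (φ x : ℂ))‖ ≤ ∫ x in a..b, -(-q x / p x ^ 2) := by
    refine intervalIntegral.norm_integral_le_of_norm_le hab (.of_forall fun x hx => ?_)
      hrc.neg.intervalIntegrable
    have hx' := Ioc_subset_Icc_self hx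
    have : -q x / p x ^ 2 ≤ 0 :=
      div_nonpos_of_nonpos_of_nonneg (neg_nonpos.2 (hq0 x hx')) (sq_nonneg _)
    rw [norm_mul, norm_mul, norm_neg, Complex.norm_I, Complex.norm_exp_I_mul_ofReal,
      Complex.norm_real, Real.norm_eq_abs, abs_of_nonpos this]
    simp
  rw [intervalIntegral.integral_neg,
    intervalIntegral.integral_eq_sub_of_hasDerivAt hr hrc.intervalIntegrable] at hbd
  have hend : ∀ x ∈ Icc a b, ‖-Complex.I * (((p x)⁻¹ : ℝ) : ℂ) *
      Complex.exp (Complex.I * (φ x : ℂ))‖ = (p x)⁻¹ := by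
    intro x hx
    rw [norm_mul, norm_mul, norm_neg, Complex.norm_I, Complex.norm_exp_I_mul_ofReal,
      Complex.norm_real, Real.norm_eq_abs, abs_of_pos (inv_pos.2 (hppos x hx))]
    simp
  have ha := left_mem_Icc.2 hab
  have hb := right_mem_Icc.2 hab
  have hinv : (p a)⁻¹ ≤ ν⁻¹ := inv_anti₀ hν (hpν a ha)
  rw [hcongr, hparts]
  refine (norm_sub_le _ _).trans ?_
  have h1 := norm_sub_le (-Complex.I * (((p b)⁻¹ : ℝ) : ℂ) * Complex.exp (Complex.I * (φ b : ℂ)))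
    (-Complex.I * (((p a)⁻¹ : ℝ) : ℂ) * Complex.exp (Complex.I * (φ a : ℂ)))
  rw [hend a ha, hend b hb] at h1
  rw [div_eq_mul_inv]
  linarith

theorem mul_sub_le_sub_of_le_hasDerivAt {p q : ℝ → ℝ} {a b μ : ℝ}
    (hp : ∀ x, HasDerivAt p (q x) x) (hqμ : ∀ x ∈ Icc a b, μ ≤ q x) {x y : ℝ}
    (hx : x ∈ Icc a b) (hy : y ∈ Icc a b) (hxy : x ≤ y) : μ * (y - x) ≤ p y - p x := by
  refine (convex_Icc a b).mul_sub_le_image_sub_of_le_deriv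
    (fun z _ => (hp z).continuousAt.continuousWithinAt)
    (fun z _ => (hp z).differentiableAt.differentiableWithinAt)
    (fun z hz => ?_) x hx y hy hxy
  rw [(hp z).deriv]
  exact hqμ z (interior_subset hz)

theorem norm_integral_cexp_le_of_deriv_nonneg {φ p q : ℝ → ℝ} {a b μ : ℝ} (hab : a ≤ b)
    (hφ : ∀ x, HasDerivAt φ (p x) x) (hp : ∀ x, HasDerivAt p (q x) x) (hq : Continuous q)
    (hμ : 0 < μ) (hqμ : ∀ x ∈ Icc a b, μ ≤ q x) (hpa : 0 ≤ p a) :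
    ‖∫ x in a..b, Complex.exp (Complex.I * (φ x : ℂ))‖ ≤ 3 / √μ := by
  have hφc : Continuous φ := continuous_iff_continuousAt.2 fun x => (hφ x).continuousAt
  have hs : 0 < √μ := Real.sqrt_pos.2 hμ
  have hss : √μ * √μ = μ := Real.mul_self_sqrt hμ.le
  have hδ : 0 < 1 / √μ := one_div_pos.2 hs
  have h3 : 3 / √μ = 1 / √μ + 2 / √μ := by ring
  rcases le_or_gt (b - a) (1 / √μ) with hle | hlt
  · have := norm_integral_cexp_le_sub (φ := φ) hab
    have : 0 < 2 / √μ := by positivity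
    linarith
  · have hac : a ≤ a + 1 / √μ := by linarith
    have hcb : a + 1 / √μ ≤ b := by linarith
    have hint := fun s t => (continuous_cexp_I_mul hφc).intervalIntegrable (μ := volume) s t
    rw [← intervalIntegral.integral_add_adjacent_intervals (hint a (a + 1 / √μ)) (hint _ b), h3]
    refine norm_add_le_of_le ((norm_integral_cexp_le_sub hac).trans (by linarith)) ?_
    have hsub : Icc (a + 1 / √μ) b ⊆ Icc a b := Icc_subset_Icc_left hac
    refine norm_integral_cexp_le_of_le_deriv hcb hφ hp hq hs (fun x hx => ?_)
      fun x hx => hμ.le.trans (hqμ x (hsub hx))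
    have h1 := mul_sub_le_sub_of_le_hasDerivAt hp hqμ (left_mem_Icc.2 hab) (hsub hx)
      (hac.trans hx.1)
    have h2 : μ * (1 / √μ) ≤ μ * (x - a) :=
      mul_le_mul_of_nonneg_left (by linarith [hx.1]) hμ.le
    have h4 : μ * (1 / √μ) = √μ := by
      rw [mul_one_div, div_eq_iff hs.ne', hss]
    linarith

theorem norm_integral_cexp_le_of_deriv_nonpos {φ p q : ℝ → ℝ} {a b μ : ℝ} (hab : a ≤ b)
    (hφ : ∀ x, HasDerivAt φ (p x) x) (hp : ∀ x, HasDerivAt p (q x) x) (hq : Continuous q)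
    (hμ : 0 < μ) (hqμ : ∀ x ∈ Icc a b, μ ≤ q x) (hpb : p b ≤ 0) :
    ‖∫ x in a..b, Complex.exp (Complex.I * (φ x : ℂ))‖ ≤ 3 / √μ := by
  have h := norm_integral_cexp_le_of_deriv_nonneg (φ := fun x => φ (-x)) (p := fun x => -p (-x))
    (q := fun x => q (-x)) (neg_le_neg hab)
    (fun x => by simpa [Function.comp_def] using (hφ (-x)).comp x (hasDerivAt_neg x))
    (fun x => by simpa [Function.comp_def] using ((hp (-x)).comp x (hasDerivAt_neg x)).fun_neg)
    (hq.comp continuous_neg) hμ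
    (fun x hx => hqμ _ ⟨by linarith [hx.2], by linarith [hx.1]⟩) (by simpa using hpb)
  rw [intervalIntegral.integral_comp_neg fun x => Complex.exp (Complex.I * (φ x : ℂ))] at h
  simpa using h

/-- Van der Corput's second derivative test. -/
theorem norm_integral_cexp_le_of_le_deriv_deriv {φ p q : ℝ → ℝ} {a b μ : ℝ} (hab : a ≤ b)
    (hφ : ∀ x, HasDerivAt φ (p x) x) (hp : ∀ x, HasDerivAt p (q x) x) (hq : Continuous q)
    (hμ : 0 < μ) (hqμ : ∀ x ∈ Icc a b, μ ≤ q x) :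
    ‖∫ x in a..b, Complex.exp (Complex.I * (φ x : ℂ))‖ ≤ 6 / √μ := by
  have hφc : Continuous φ := continuous_iff_continuousAt.2 fun x => (hφ x).continuousAt
  have hpc : Continuous p := continuous_iff_continuousAt.2 fun x => (hp x).continuousAt
  have h6 : 6 / √μ = 3 / √μ + 3 / √μ := by ring
  have h3 : 0 ≤ 3 / √μ := by positivity
  rw [h6]
  rcases le_total 0 (p a) with hpa | hpa
  · linarith [norm_integral_cexp_le_of_deriv_nonneg hab hφ hp hq hμ hqμ hpa]
  rcases le_total (p b) 0 with hpb | hpb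
  · linarith [norm_integral_cexp_le_of_deriv_nonpos hab hφ hp hq hμ hqμ hpb]
  obtain ⟨c, hc, hpc0⟩ := intermediate_value_Icc hab hpc.continuousOn ⟨hpa, hpb⟩
  have hint := fun s t => (continuous_cexp_I_mul hφc).intervalIntegrable (μ := volume) s t
  rw [← intervalIntegral.integral_add_adjacent_intervals (hint a c) (hint c b)]
  exact norm_add_le_of_le
    (norm_integral_cexp_le_of_deriv_nonpos hc.1 hφ hp hq hμ
      (fun x hx => hqμ x (Icc_subset_Icc_right hc.2 hx)) hpc0.le)
    (norm_integral_cexp_le_of_deriv_nonneg hc.2 hφ hp hq hμ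
      (fun x hx => hqμ x (Icc_subset_Icc_left hc.1 hx)) hpc0.ge)

/-- The second derivative test with an amplitude. -/
theorem norm_integral_cexp_mul_le {φ p q : ℝ → ℝ} {f f' : ℝ → ℂ} {a b μ M M' : ℝ} (hab : a ≤ b)
    (hφ : ∀ x, HasDerivAt φ (p x) x) (hp : ∀ x, HasDerivAt p (q x) x) (hq : Continuous q)
    (hμ : 0 < μ) (hqμ : ∀ x ∈ Icc a b, μ ≤ q x)
    (hf : ∀ x, HasDerivAt f (f' x) x) (hf' : Continuous f')
    (hM : ∀ x, ‖f x‖ ≤ M) (hM' : ∀ x, ‖f' x‖ ≤ M') :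
    ‖∫ x in a..b, Complex.exp (Complex.I * (φ x : ℂ)) * f x‖ ≤ 6 / √μ * (M + M' * (b - a)) := by
  have hφc : Continuous φ := continuous_iff_continuousAt.2 fun x => (hφ x).continuousAt
  have hec := continuous_cexp_I_mul hφc
  have hF : ∀ x ∈ Icc a b, ‖∫ t in a..x, Complex.exp (Complex.I * (φ t : ℂ))‖ ≤ 6 / √μ :=
    fun x hx => norm_integral_cexp_le_of_le_deriv_deriv hx.1 hφ hp hq hμ
      fun t ht => hqμ t (Icc_subset_Icc_right hx.2 ht)
  have hparts := intervalIntegral.integral_mul_deriv_eq_deriv_mul (a := a) (b := b)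
    (fun x _ => hf x) (fun x _ => (hec.integral_hasStrictDerivAt a x).hasDerivAt)
    (hf'.intervalIntegrable _ _) (hec.intervalIntegrable _ _)
  simp_rw [mul_comm (Complex.exp _)]
  have h6 : 0 ≤ 6 / √μ := by positivity
  have hM0 : 0 ≤ M := (norm_nonneg _).trans (hM a)
  have hM'0 : 0 ≤ M' := (norm_nonneg _).trans (hM' a)
  rw [hparts, intervalIntegral.integral_same, mul_zero, sub_zero]
  have h1 : ‖f b * ∫ t in a..b, Complex.exp (Complex.I * (φ t : ℂ))‖ ≤ M * (6 / √μ) := by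
    rw [norm_mul]
    exact mul_le_mul (hM b) (hF b (right_mem_Icc.2 hab)) (norm_nonneg _) hM0
  have h2 := intervalIntegral.norm_integral_le_of_norm_le_const (a := a) (b := b)
    (C := M' * (6 / √μ))
    (f := fun x => f' x * ∫ t in a..x, Complex.exp (Complex.I * (φ t : ℂ))) fun x hx => by
      rw [uIoc_of_le hab] at hx
      rw [norm_mul]
      exact mul_le_mul (hM' x) (hF x (Ioc_subset_Icc_self hx)) (norm_nonneg _) hM'0
  rw [abs_of_nonneg (sub_nonneg.2 hab)] at h2
  refine (norm_sub_le _ _).trans ?_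
  linarith

theorem norm_setIntegral_cexp_mul_le {φ p q : ℝ → ℝ} {f f' : ℝ → ℂ} {l r μ M M' : ℝ} {S : Set ℝ}
    (hφ : ∀ x, HasDerivAt φ (p x) x) (hp : ∀ x, HasDerivAt p (q x) x) (hq : Continuous q)
    (hμ : 0 < μ) (hS : S.OrdConnected) (hSlr : S ⊆ Icc l r) (hlr : l ≤ r)
    (hqμ : ∀ x ∈ S, μ ≤ q x)
    (hf : ∀ x, HasDerivAt f (f' x) x) (hf' : Continuous f')
    (hM : ∀ x, ‖f x‖ ≤ M) (hM' : ∀ x, ‖f' x‖ ≤ M') :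
    ‖∫ x in S, Complex.exp (Complex.I * (φ x : ℂ)) * f x‖ ≤ 6 / √μ * (M + M' * (r - l)) := by
  have hM0 : 0 ≤ M := (norm_nonneg _).trans (hM l)
  have hM'0 : 0 ≤ M' := (norm_nonneg _).trans (hM' l)
  have h6 : 0 ≤ 6 / √μ := by positivity
  rcases S.eq_empty_or_nonempty with rfl | hne
  · have : 0 ≤ M' * (r - l) := mul_nonneg hM'0 (sub_nonneg.2 hlr)
    simpa using mul_nonneg h6 (add_nonneg hM0 this)
  have hbb : BddBelow S := bddBelow_Icc.mono hSlr
  have hba : BddAbove S := bddAbove_Icc.mono hSlr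
  have hIoo : Ioo (sInf S) (sSup S) ⊆ S :=
    IsConnected.Ioo_csInf_csSup_subset ⟨hne, hS.isPreconnected⟩ hbb hba
  have hIcc : S ⊆ Icc (sInf S) (sSup S) := subset_Icc_csInf_csSup hbb hba
  have hae : S =ᵐ[volume] Ioc (sInf S) (sSup S) :=
    (hIcc.eventuallyLE.trans Ioc_ae_eq_Icc.symm.le).antisymm
      (Ioo_ae_eq_Ioc.symm.le.trans hIoo.eventuallyLE)
  have hle : sInf S ≤ sSup S := csInf_le_csSup hne hbb hba
  have hcl : Icc (sInf S) (sSup S) ⊆ closure S := by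
    rcases hle.eq_or_lt with heq | hlt
    · rw [← heq, Icc_self, singleton_subset_iff]
      exact csInf_mem_closure hne hbb
    · rw [← closure_Ioo hlt.ne]
      exact closure_mono hIoo
  have hqcl : ∀ x ∈ Icc (sInf S) (sSup S), μ ≤ q x := fun x hx =>
    closure_minimal (t := {x | μ ≤ q x}) hqμ (isClosed_le continuous_const hq) (hcl hx)
  rw [setIntegral_congr_set hae, ← intervalIntegral.integral_of_le hle]
  refine (norm_integral_cexp_mul_le hle hφ hp hq hμ hqcl hf hf' hM hM').trans ?_
  have h1 : l ≤ sInf S := le_csInf hne fun x hx => (hSlr hx).1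
  have h2 : sSup S ≤ r := csSup_le hne fun x hx => (hSlr hx).2
  gcongr

theorem norm_setIntegral_cexp_mul_conj (φ : ℝ → ℝ) (f : ℝ → ℂ) (S : Set ℝ) :
    ‖∫ x in S, Complex.exp (Complex.I * (φ x : ℂ)) * f x‖ =
      ‖∫ x in S, Complex.exp (Complex.I * ((-φ x : ℝ) : ℂ)) * star (f x)‖ := by
  rw [← Complex.norm_conj, ← integral_conj]
  congr 2
  ext x
  rw [map_mul, ← Complex.exp_conj, map_mul, Complex.conj_I, Complex.conj_ofReal]
  simp

theorem norm_setIntegral_cexp_mul_le_of_le_neg {φ p q : ℝ → ℝ} {f f' : ℝ → ℂ} {l r μ M M' : ℝ}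
    {S : Set ℝ}
    (hφ : ∀ x, HasDerivAt φ (p x) x) (hp : ∀ x, HasDerivAt p (q x) x) (hq : Continuous q)
    (hμ : 0 < μ) (hS : S.OrdConnected) (hSlr : S ⊆ Icc l r) (hlr : l ≤ r)
    (hqμ : ∀ x ∈ S, μ ≤ -q x)
    (hf : ∀ x, HasDerivAt f (f' x) x) (hf' : Continuous f')
    (hM : ∀ x, ‖f x‖ ≤ M) (hM' : ∀ x, ‖f' x‖ ≤ M') :
    ‖∫ x in S, Complex.exp (Complex.I * (φ x : ℂ)) * f x‖ ≤ 6 / √μ * (M + M' * (r - l)) := by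
  have h := norm_setIntegral_cexp_mul_le (φ := fun x => -φ x) (p := fun x => -p x)
    (q := fun x => -q x) (f := fun x => star (f x)) (f' := fun x => star (f' x))
    (fun x => (hφ x).fun_neg) (fun x => (hp x).fun_neg) hq.neg hμ hS hSlr hlr hqμ
    (fun x => (hf x).star) hf'.star (fun x => by rw [norm_star]; exact hM x)
    (fun x => by rw [norm_star]; exact hM' x)
  rwa [← norm_setIntegral_cexp_mul_conj] at h

theorem HasDerivAt.nonpos_of_forall_right_le {g : ℝ → ℝ} {d m y : ℝ} (hg : HasDerivAt g d m)
    (hmy : m < y) (hle : ∀ z ∈ Ioo m y, g z ≤ g m) : d ≤ 0 := by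
  have ht := (hasDerivAt_iff_tendsto_slope.1 hg).mono_left
    (nhdsWithin_mono m (s := Ioi m) fun z hz => (mem_Ioi.1 hz).ne')
  refine le_of_tendsto ht ?_
  filter_upwards [Ioo_mem_nhdsGT hmy] with z hz
  rw [slope_def_field]
  exact div_nonpos_of_nonpos_of_nonneg (sub_nonpos.2 (hle z hz)) (sub_nonneg.2 hz.1.le)

theorem HasDerivAt.nonneg_of_forall_left_le {g : ℝ → ℝ} {d m y : ℝ} (hg : HasDerivAt g d m)
    (hym : y < m) (hle : ∀ z ∈ Ioo y m, g z ≤ g m) : 0 ≤ d := by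
  have ht := (hasDerivAt_iff_tendsto_slope.1 hg).mono_left
    (nhdsWithin_mono m (s := Iio m) fun z hz => (mem_Iio.1 hz).ne)
  refine ge_of_tendsto ht ?_
  filter_upwards [Ioo_mem_nhdsLT hym] with z hz
  rw [slope_def_field]
  exact div_nonneg_of_nonpos (sub_nonpos.2 (hle z hz)) (sub_nonpos.2 hz.2.le)

/-- If `g` has no critical point where it exceeds `c`, then the set where it exceeds `c` while
increasing is an interval. -/
theorem ordConnected_setOf_lt_and_deriv_pos {g q : ℝ → ℝ} {l r c : ℝ}
    (hg : ∀ x, HasDerivAt g (q x) x) (hq : ∀ x ∈ Icc l r, c < g x → q x ≠ 0) :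
    {x | x ∈ Icc l r ∧ c < g x ∧ 0 < q x}.OrdConnected := by
  refine ordConnected_iff.2 fun x ⟨hx, hcx, hqx⟩ w ⟨hw, _⟩ _ y ⟨hxy, hyw⟩ => ?_
  have hy : y ∈ Icc l r := ⟨hx.1.trans hxy, hyw.trans hw.2⟩
  rcases hxy.eq_or_lt with rfl | hlt
  · exact ⟨hx, hcx, hqx⟩
  obtain ⟨m, hm, hmax⟩ := isCompact_Icc.exists_isMaxOn (nonempty_Icc.2 hxy)
    (f := g) fun z _ => (hg z).continuousAt.continuousWithinAt
  have hmax : ∀ z ∈ Icc x y, g z ≤ g m := hmax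
  have hcm : c < g m := hcx.trans_le (hmax x (left_mem_Icc.2 hxy))
  have hqm := hq m ⟨hx.1.trans hm.1, hm.2.trans hy.2⟩ hcm
  have hpos : 0 < q m := by
    rcases hm.1.eq_or_lt with rfl | hxm
    · exact hqx
    · exact lt_of_le_of_ne ((hg m).nonneg_of_forall_left_le hxm fun z hz =>
        hmax z ⟨hz.1.le, hz.2.le.trans hm.2⟩) hqm.symm
  rcases hm.2.eq_or_lt with rfl | hmy
  · exact ⟨hy, hcm, hpos⟩
  · exact absurd ((hg m).nonpos_of_forall_right_le hmy fun z hz =>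
      hmax z ⟨hm.1.trans hz.1.le, hz.2.le⟩) hpos.not_ge

theorem ordConnected_setOf_lt_and_deriv_neg {g q : ℝ → ℝ} {l r c : ℝ}
    (hg : ∀ x, HasDerivAt g (q x) x) (hq : ∀ x ∈ Icc l r, c < g x → q x ≠ 0) :
    {x | x ∈ Icc l r ∧ c < g x ∧ q x < 0}.OrdConnected := by
  have h := ordConnected_setOf_lt_and_deriv_pos (g := fun x => g (-x)) (q := fun x => -q (-x))
    (l := -r) (r := -l) (c := c)
    (fun x => by simpa [Function.comp_def] using (hg (-x)).comp x (hasDerivAt_neg x))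
    (fun x hx hc => neg_ne_zero.2 (hq (-x) ⟨by linarith [hx.2], by linarith [hx.1]⟩ hc))
  convert h.preimage_anti (f := fun x : ℝ => -x) fun _ _ h => neg_le_neg h using 1
  ext x
  simp [and_comm]

theorem norm_setIntegral_union_le {f : ℝ → ℂ} {S T : Set ℝ} {A B : ℝ} (hST : Disjoint S T)
    (hT : MeasurableSet T) (hfS : IntegrableOn f S) (hfT : IntegrableOn f T)
    (hA : ‖∫ x in S, f x‖ ≤ A) (hB : ‖∫ x in T, f x‖ ≤ B) : ‖∫ x in S ∪ T, f x‖ ≤ A + B := by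
  rw [setIntegral_union hST hT hfS hfT]
  exact norm_add_le_of_le hA hB

theorem norm_setIntegral_cexp_mul_le_of_lt {φ p g q : ℝ → ℝ} {f f' : ℝ → ℂ}
    {l r c μ M M' : ℝ}
    (hφ : ∀ x, HasDerivAt φ (p x) x) (hp : ∀ x, HasDerivAt p (q x) x)
    (hg : ∀ x, HasDerivAt g (q x) x) (hq : Continuous q)
    (hμ : 0 < μ) (hlr : l ≤ r) (hqμ : ∀ x ∈ Icc l r, c < g x → μ ≤ |q x|)
    (hf : ∀ x, HasDerivAt f (f' x) x) (hf' : Continuous f')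
    (hM : ∀ x, ‖f x‖ ≤ M) (hM' : ∀ x, ‖f' x‖ ≤ M') :
    ‖∫ x in {x | x ∈ Icc l r ∧ c < g x}, Complex.exp (Complex.I * (φ x : ℂ)) * f x‖ ≤
      12 / √μ * (M + M' * (r - l)) := by
  have hφc : Continuous φ := continuous_iff_continuousAt.2 fun x => (hφ x).continuousAt
  have hfc : Continuous f := continuous_iff_continuousAt.2 fun x => (hf x).continuousAt
  have hint : IntegrableOn (fun x => Complex.exp (Complex.I * (φ x : ℂ)) * f x) (Icc l r) :=
    ((continuous_cexp_I_mul hφc).mul hfc).integrableOn_Icc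
  have hq0 : ∀ x ∈ Icc l r, c < g x → q x ≠ 0 := fun x hx hc =>
    abs_pos.1 (hμ.trans_le (hqμ x hx hc))
  have hpos := ordConnected_setOf_lt_and_deriv_pos hg hq0
  have hneg := ordConnected_setOf_lt_and_deriv_neg hg hq0
  have hset : {x | x ∈ Icc l r ∧ c < g x} = {x | x ∈ Icc l r ∧ c < g x ∧ 0 < q x} ∪
      {x | x ∈ Icc l r ∧ c < g x ∧ q x < 0} := by
    ext x
    constructor
    · rintro ⟨hx, hc⟩
      rcases (hq0 x hx hc).lt_or_gt with h | h
      · exact .inr ⟨hx, hc, h⟩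
      · exact .inl ⟨hx, hc, h⟩
    · rintro (⟨hx, hc, _⟩ | ⟨hx, hc, _⟩) <;> exact ⟨hx, hc⟩
  have h12 : 12 / √μ * (M + M' * (r - l)) =
      6 / √μ * (M + M' * (r - l)) + 6 / √μ * (M + M' * (r - l)) := by ring
  rw [hset, h12]
  refine norm_setIntegral_union_le (disjoint_left.2 fun x hx hx' => hx.2.2.not_gt hx'.2.2)
    hneg.measurableSet (hint.mono_set fun x hx => hx.1) (hint.mono_set fun x hx => hx.1)
    (norm_setIntegral_cexp_mul_le hφ hp hq hμ hpos (fun x hx => hx.1) hlr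
      (fun x hx => ?_) hf hf' hM hM')
    (norm_setIntegral_cexp_mul_le_of_le_neg hφ hp hq hμ hneg (fun x hx => hx.1) hlr
      (fun x hx => ?_) hf hf' hM hM')
  · rw [← abs_of_pos hx.2.2]
    exact hqμ x hx.1 hx.2.1
  · rw [← abs_of_neg hx.2.2]
    exact hqμ x hx.1 hx.2.1

theorem norm_setIntegral_cexp_mul_le_of_lt_abs {φ p g q : ℝ → ℝ} {f f' : ℝ → ℂ}
    {l r c μ M M' : ℝ}
    (hφ : ∀ x, HasDerivAt φ (p x) x) (hp : ∀ x, HasDerivAt p (q x) x)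
    (hg : ∀ x, HasDerivAt g (q x) x) (hq : Continuous q) (hc : 0 ≤ c)
    (hμ : 0 < μ) (hlr : l ≤ r) (hqμ : ∀ x ∈ Icc l r, c < |g x| → μ ≤ |q x|)
    (hf : ∀ x, HasDerivAt f (f' x) x) (hf' : Continuous f')
    (hM : ∀ x, ‖f x‖ ≤ M) (hM' : ∀ x, ‖f' x‖ ≤ M') :
    ‖∫ x in {x | x ∈ Icc l r ∧ c < |g x|}, Complex.exp (Complex.I * (φ x : ℂ)) * f x‖ ≤
      24 / √μ * (M + M' * (r - l)) := by
  have hφc : Continuous φ := continuous_iff_continuousAt.2 fun x => (hφ x).continuousAt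
  have hfc : Continuous f := continuous_iff_continuousAt.2 fun x => (hf x).continuousAt
  have hgc : Continuous g := continuous_iff_continuousAt.2 fun x => (hg x).continuousAt
  have hint : IntegrableOn (fun x => Complex.exp (Complex.I * (φ x : ℂ)) * f x) (Icc l r) :=
    ((continuous_cexp_I_mul hφc).mul hfc).integrableOn_Icc
  have hset : {x | x ∈ Icc l r ∧ c < |g x|} =
      {x | x ∈ Icc l r ∧ c < g x} ∪ {x | x ∈ Icc l r ∧ c < -g x} := by
    ext x
    simp only [mem_ofPred_eq, mem_union, lt_abs, and_or_left]
  have h24 : 24 / √μ * (M + M' * (r - l)) =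
      12 / √μ * (M + M' * (r - l)) + 12 / √μ * (M + M' * (r - l)) := by ring
  rw [hset, h24]
  refine norm_setIntegral_union_le
    (disjoint_left.2 fun x hx hx' => by linarith [hx.2, hx'.2])
    (measurableSet_Icc.inter (measurableSet_lt measurable_const hgc.neg.measurable))
    (hint.mono_set fun x hx => hx.1) (hint.mono_set fun x hx => hx.1)
    (norm_setIntegral_cexp_mul_le_of_lt hφ hp hg hq hμ hlr
      (fun x hx h => hqμ x hx (lt_abs.2 (.inl h))) hf hf' hM hM') ?_
  rw [norm_setIntegral_cexp_mul_conj]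
  exact norm_setIntegral_cexp_mul_le_of_lt (fun x => (hφ x).fun_neg) (fun x => (hp x).fun_neg)
    (fun x => (hg x).fun_neg) hq.neg hμ hlr
    (fun x hx h => by rw [abs_neg]; exact hqμ x hx (lt_abs.2 (.inr h)))
    (fun x => (hf x).star) hf'.star (fun x => by rw [norm_star]; exact hM x)
    (fun x => by rw [norm_star]; exact hM' x)

theorem statement11 (ψ : ℝ → ℝ) (hψ : ContDiff ℝ (⊤ : ℕ∞) ψ) (hψc : HasCompactSupport ψ)
    (hψs : tsupport ψ ⊆ Set.Ioo (-2 : ℝ) (-1/2) ∪ Set.Ioo (1/2 : ℝ) 2)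
    (C₂ : ℝ) (hC₂ : 0 < C₂) :
    ∃ C : ℝ, 0 < C ∧
      ∀ Φ : ℝ → ℝ, ContDiff ℝ 2 Φ →
      (∀ ξ : ℝ, 1 ≤ |ξ| → C₂ * |deriv Φ ξ| ≤ |ξ| * |deriv (deriv Φ) ξ|) →
      ∀ lam η τ : ℝ, 2 ≤ lam → η ≠ 0 →
      (∀ ξ : ℝ, ξ ∈ {ξ : ℝ | |η| < 2 * |τ| * |deriv Φ (lam * ξ)|} →
        1/2 ≤ |ξ| → |ξ| ≤ 2 →
        (C₂ / 4) * (lam * |η|) ≤ lam ^ 2 * |τ| * |deriv (deriv Φ) (lam * ξ)|) ∧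
      ‖∫ ξ in {ξ : ℝ | |η| < 2 * |τ| * |deriv Φ (lam * ξ)|},
          Complex.exp (Complex.I * ((η * (lam * ξ) + τ * Φ (lam * ξ) : ℝ) : ℂ)) *
            ((ψ ξ : ℝ) : ℂ) ^ 2‖
        ≤ C * (lam * |η|) ^ (-(1 : ℝ) / 2) := by
  have hψd : ∀ x, HasDerivAt ψ (deriv ψ x) x := fun x =>
    (hψ.differentiable (by simp)).differentiableAt.hasDerivAt
  have hψ' : Continuous (deriv ψ) := hψ.continuous_deriv (by simp)
  obtain ⟨A, hA⟩ := hψc.exists_bound_of_continuous hψ.continuous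
  obtain ⟨B, hB⟩ := hψc.deriv.exists_bound_of_continuous hψ'
  have hA0 : 0 ≤ A := (norm_nonneg _).trans (hA 0)
  have hB0 : 0 ≤ B := (norm_nonneg _).trans (hB 0)
  have hf : ∀ x, HasDerivAt (fun x => (ψ x : ℂ) ^ 2) (2 * (ψ x : ℂ) * ((deriv ψ x : ℝ) : ℂ)) x := by
    intro x
    simpa using (hψd x).ofReal_comp.fun_pow 2
  have hf' : Continuous fun x => 2 * (ψ x : ℂ) * ((deriv ψ x : ℝ) : ℂ) := by
    have := hψ.continuous
    fun_prop
  have hM : ∀ x, ‖(ψ x : ℂ) ^ 2‖ ≤ A ^ 2 := fun x => by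
    rw [norm_pow, Complex.norm_real]
    exact pow_le_pow_left₀ (norm_nonneg _) (hA x) 2
  have hM' : ∀ x, ‖2 * (ψ x : ℂ) * ((deriv ψ x : ℝ) : ℂ)‖ ≤ 2 * A * B := fun x => by
    rw [norm_mul, norm_mul, Complex.norm_real, Complex.norm_real, Complex.norm_two]
    gcongr
    exacts [hA x, hB x]
  refine ⟨48 / √(C₂ / 4) * (A ^ 2 + 2 * A * B * (3 / 2) + 1), by positivity, ?_⟩
  intro Φ hΦ hΦC lam η τ hlam hη
  have hlam0 : 0 < lam := by linarith
  have hη0 : 0 < |η| := abs_pos.2 hη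
  have hlower : ∀ ξ : ℝ, ξ ∈ {ξ : ℝ | |η| < 2 * |τ| * |deriv Φ (lam * ξ)|} →
      1/2 ≤ |ξ| → |ξ| ≤ 2 →
      (C₂ / 4) * (lam * |η|) ≤ lam ^ 2 * |τ| * |deriv (deriv Φ) (lam * ξ)| := by
    intro ξ hξ h1 h2
    have hξ : |η| < 2 * |τ| * |deriv Φ (lam * ξ)| := hξ
    have habs : |lam * ξ| = lam * |ξ| := by rw [abs_mul, abs_of_pos hlam0]
    have h := hΦC (lam * ξ) (by rw [habs]; nlinarith)
    rw [habs] at h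
    have h3 : lam * |ξ| * |deriv (deriv Φ) (lam * ξ)| ≤
        lam * 2 * |deriv (deriv Φ) (lam * ξ)| := by gcongr
    calc C₂ / 4 * (lam * |η|) ≤ C₂ / 4 * (lam * (2 * |τ| * |deriv Φ (lam * ξ)|)) := by gcongr
      _ = lam * |τ| / 2 * (C₂ * |deriv Φ (lam * ξ)|) := by ring
      _ ≤ lam * |τ| / 2 * (lam * 2 * |deriv (deriv Φ) (lam * ξ)|) :=
        mul_le_mul_of_nonneg_left (h.trans h3) (by positivity)
      _ = lam ^ 2 * |τ| * |deriv (deriv Φ) (lam * ξ)| := by ring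
  refine ⟨hlower, ?_⟩
  have hΦ1 : ContDiff ℝ 1 (deriv Φ) :=
    ContDiff.deriv' (by rwa [one_add_one_eq_two])
  have hΦd : ∀ x, HasDerivAt Φ (deriv Φ x) x := fun x =>
    (hΦ.differentiable (by simp)).differentiableAt.hasDerivAt
  have hΦdd : ∀ x, HasDerivAt (deriv Φ) (deriv (deriv Φ) x) x := fun x =>
    (hΦ1.differentiable (by simp)).differentiableAt.hasDerivAt
  have hlin : ∀ x, HasDerivAt (fun x => lam * x) lam x := fun x => by
    simpa using (hasDerivAt_id x).const_mul lam
  have hφ : ∀ x, HasDerivAt (fun x => η * (lam * x) + τ * Φ (lam * x))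
      (η * lam + τ * (deriv Φ (lam * x) * lam)) x := fun x =>
    ((hlin x).const_mul η).add (((hΦd (lam * x)).comp x (hlin x)).const_mul τ)
  have hg : ∀ x, HasDerivAt (fun x => τ * (deriv Φ (lam * x) * lam))
      (τ * (deriv (deriv Φ) (lam * x) * lam * lam)) x := fun x =>
    (((hΦdd (lam * x)).comp x (hlin x)).mul_const lam).const_mul τ
  have hp : ∀ x, HasDerivAt (fun x => η * lam + τ * (deriv Φ (lam * x) * lam))
      (τ * (deriv (deriv Φ) (lam * x) * lam * lam)) x := fun x => (hg x).const_add _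
  have hq : Continuous fun x => τ * (deriv (deriv Φ) (lam * x) * lam * lam) := by
    have := hΦ1.continuous_deriv le_rfl
    fun_prop
  have hmem : ∀ x, |η| < 2 * |τ| * |deriv Φ (lam * x)| ↔
      lam * |η| / 2 < |τ * (deriv Φ (lam * x) * lam)| := by
    intro x
    rw [abs_mul, abs_mul, abs_of_pos hlam0]
    constructor
    · intro h
      nlinarith
    · intro h
      by_contra! h'
      nlinarith
  have hμ : 0 < C₂ / 4 * (lam * |η|) := by positivity
  have hqμ : ∀ x, 1 / 2 ≤ |x| → |x| ≤ 2 → lam * |η| / 2 < |τ * (deriv Φ (lam * x) * lam)| →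
      C₂ / 4 * (lam * |η|) ≤ |τ * (deriv (deriv Φ) (lam * x) * lam * lam)| := by
    intro x h1 h2 h
    refine (hlower x ((hmem x).2 h) h1 h2).trans_eq ?_
    rw [abs_mul, abs_mul, abs_mul, abs_of_pos hlam0]
    ring
  have hpos := norm_setIntegral_cexp_mul_le_of_lt_abs (l := 1 / 2) (r := 2) (c := lam * |η| / 2)
    hφ hp hg hq (by positivity) hμ (by norm_num) (fun x hx =>
      hqμ x (hx.1.trans (le_abs_self x)) (abs_le.2 ⟨by linarith [hx.1], hx.2⟩)) hf hf' hM hM'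
  have hneg := norm_setIntegral_cexp_mul_le_of_lt_abs (l := -2) (r := -1 / 2)
    (c := lam * |η| / 2) hφ hp hg hq (by positivity) hμ (by norm_num) (fun x hx =>
      hqμ x (by linarith [neg_le_abs x, hx.2]) (abs_le.2 ⟨hx.1, by linarith [hx.2]⟩))
      hf hf' hM hM'
  simp_rw [← hmem] at hpos hneg
  have hφc : Continuous fun x => η * (lam * x) + τ * Φ (lam * x) :=
    continuous_iff_continuousAt.2 fun x => (hφ x).continuousAt
  have hcont : Continuous fun x => Complex.exp
      (Complex.I * ((η * (lam * x) + τ * Φ (lam * x) : ℝ) : ℂ)) * (ψ x : ℂ) ^ 2 :=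
    (continuous_cexp_I_mul hφc).mul ((Complex.continuous_ofReal.comp hψ.continuous).pow 2)
  have hUmeas : MeasurableSet {x : ℝ | |η| < 2 * |τ| * |deriv Φ (lam * x)|} :=
    measurableSet_lt measurable_const (by have := hΦ1.continuous; fun_prop)
  have hunion := norm_setIntegral_union_le
    (disjoint_left.2 fun x hx hx' => by linarith [hx.1.1, hx'.1.2])
    (measurableSet_Icc.inter hUmeas)
    (hcont.integrableOn_Icc.mono_set fun x hx => hx.1)
    (hcont.integrableOn_Icc.mono_set fun x hx => hx.1) hpos hneg
  rw [setIntegral_eq_of_subset_of_forall_sdiff_eq_zero hUmeas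
    (s := {x | x ∈ Icc (1 / 2) 2 ∧ |η| < 2 * |τ| * |deriv Φ (lam * x)|} ∪
      {x | x ∈ Icc (-2) (-1 / 2) ∧ |η| < 2 * |τ| * |deriv Φ (lam * x)|})
    (union_subset (fun x hx => hx.2) fun x hx => hx.2)]
  · refine hunion.trans ?_
    have hpow : (lam * |η|) ^ (-(1 : ℝ) / 2) = (√(lam * |η|))⁻¹ := by
      rw [Real.sqrt_eq_rpow, ← Real.rpow_neg (by positivity)]
      norm_num
    rw [hpow, Real.sqrt_mul (by positivity)]
    have hs : 0 < √(C₂ / 4) := Real.sqrt_pos.2 (by positivity)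
    have ht : 0 < √(lam * |η|) := Real.sqrt_pos.2 (by positivity)
    have hextra : 0 ≤ 48 / √(C₂ / 4) * (√(lam * |η|))⁻¹ := by positivity
    calc _ = 48 / √(C₂ / 4) * (√(lam * |η|))⁻¹ * (A ^ 2 + 2 * A * B * (3 / 2)) := by
          field_simp
          ring
      _ ≤ _ := by linarith
  · intro x hx
    have hψ0 : ψ x = 0 := by
      by_contra hne
      rcases hψs (subset_tsupport ψ hne) with h | h
      · exact hx.2 (.inr ⟨⟨h.1.le, h.2.le⟩, hx.1⟩)
      · exact hx.2 (.inl ⟨⟨h.1.le, h.2.le⟩, hx.1⟩)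
    rw [hψ0]
    simp
end
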